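/- Let k be a field and let I be a radical ideal of R = k[x,y,z] that is an irredundant intersection of prime ideals of height 2. If I is minimally generated by at least four elements, then I is syzygetic and rt(I) ≥ 3. -/

import Mathlib

open Polynomial MvPolynomial

/-- The kernel of the graded presentation `R[t₁,…,t_s] → 𝐑(I) ⊆ R[X]` of the Rees algebra
of the ideal generated by `f`, sending `tᵢ` to `(f i)·X`. -/
noncomputable def reesKer {R : Type*} [CommRing R] {s : ℕ} (f : Fin s → R) :
    Ideal (MvPolynomial (Fin s) R) :=
  RingHom.ker (MvPolynomial.aeval
    (fun i => Polynomial.C (f i) * Polynomial.X) : MvPolynomial (Fin s) R →ₐ[R] Polynomial R)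

/-- `L` is generated by its homogeneous elements of degree at most `N`. -/
def GenInDegLE {R : Type*} [CommRing R] {s : ℕ}
    (L : Ideal (MvPolynomial (Fin s) R)) (N : ℕ) : Prop :=
  L = Ideal.span {p | p ∈ L ∧ ∃ q ≤ N, MvPolynomial.IsHomogeneous p q}

/-- The relation type of an ideal `I`: the least `N ≥ 1` such that, for every finite
generating family of `I`, the ideal of equations of the corresponding presentation of the
Rees algebra is generated by its homogeneous elements of degree at most `N`. -/
noncomputable def relType {R : Type*} [CommRing R] (I : Ideal R) : ℕ :=
  sInf {N | 1 ≤ N ∧ ∀ (s : ℕ) (f : Fin s → R),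
    Ideal.span (Set.range f) = I → GenInDegLE (reesKer f) N}

/-- The height of an ideal `J` of `R`: the infimum of the heights (in the sense of lengths of
chains in `Spec R`) of the primes containing `J`. -/
noncomputable def idealHeight {R : Type*} [CommRing R] (J : Ideal R) : ℕ∞ :=
  ⨅ P : {P : PrimeSpectrum R // J ≤ P.asIdeal}, Order.height P.1

/-- For a radical ideal `I`, the `i`-th equidimensional component of `I`: the intersection of
the (primary = prime, since `I` is radical) components of `I` of height `i`, i.e. of the minimal
primes of `I` of height `i`; it equals `R` (the whole ring) if there are none. -/
noncomputable def equidimComponent {R : Type*} [CommRing R] (I : Ideal R) (i : ℕ) : Ideal R :=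
  sInf {P | P ∈ I.minimalPrimes ∧ idealHeight P = (i : ℕ∞)}

/-- An ideal `I` is *syzygetic* if the canonical map `α₂ : S₂(I) → I²` is an isomorphism;
equivalently, for every presentation of the Rees algebra of `I`, the degree-`2` equations are
generated by the linear ones (`L₂ = S₁·L₁`, i.e. `E(I)₂ = 0`). -/
def Syzygetic {R : Type*} [CommRing R] (I : Ideal R) : Prop :=
  ∀ (s : ℕ) (f : Fin s → R), Ideal.span (Set.range f) = I →
    ∀ p ∈ reesKer f, p.IsHomogeneous 2 →
      p ∈ Ideal.span {q | q ∈ reesKer f ∧ q.IsHomogeneous 1}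

section LocalGeneration

variable {A : Type*} [CommRing A] {M : Type*} [AddCommGroup M] [Module A M]

/-- The localization of `M` at `p` is generated by `i` elements. -/
def LocGenLE (M : Type*) [AddCommGroup M] [Module A M] (p : Ideal A) (i : ℕ) : Prop :=
  ∃ a ∉ p, ∃ m : Fin i → M, ∀ x : M, a • x ∈ Submodule.span A (Set.range m)

/-- The ideal whose zero locus is the set of primes at which `M` is not generated by `i`
elements. -/
def locGenIdeal (A : Type*) [CommRing A] (M : Type*) [AddCommGroup M] [Module A M] (i : ℕ) :
    Ideal A :=
  Ideal.span {a | ∃ m : Fin i → M, ∀ x : M, a • x ∈ Submodule.span A (Set.range m)}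

/-- The image of `u` in the localization of `M` at `p` lies in `p M_p`. -/
def NonBasic (p : Ideal A) (u : M) : Prop :=
  ∃ a ∉ p, a • u ∈ p • (⊤ : Submodule A M)

lemma locGenLE_iff {p : Ideal A} {i : ℕ} : LocGenLE M p i ↔ ¬ locGenIdeal A M i ≤ p := by
  rw [locGenIdeal, Ideal.span_le, Set.not_subset]
  constructor
  · rintro ⟨a, ha, m, hm⟩
    exact ⟨a, ⟨m, hm⟩, ha⟩
  · rintro ⟨a, ⟨m, hm⟩, ha⟩
    exact ⟨a, ha, m, hm⟩

lemma LocGenLE.of_surjective {M' : Type*} [AddCommGroup M'] [Module A M'] {p : Ideal A} {i : ℕ}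
    (h : LocGenLE M p i) (g : M →ₗ[A] M') (hg : Function.Surjective g) : LocGenLE M' p i := by
  obtain ⟨a, ha, m, hm⟩ := h
  refine ⟨a, ha, g ∘ m, fun x => ?_⟩
  obtain ⟨x, rfl⟩ := hg x
  rw [Set.range_comp, ← Submodule.map_span, ← map_smul]
  exact Submodule.mem_map_of_mem (hm x)

lemma LocGenLE.mono {p : Ideal A} {i j : ℕ} (h : LocGenLE M p i) (hij : i ≤ j) :
    LocGenLE M p j := by
  obtain ⟨a, ha, m, hm⟩ := h
  refine ⟨a, ha, fun l => if hl : l.1 < i then m ⟨l, hl⟩ else 0, fun x => ?_⟩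
  refine Submodule.span_mono ?_ (hm x)
  rintro _ ⟨l, rfl⟩
  exact ⟨⟨l, by omega⟩, by simp⟩

lemma NonBasic.add {p : Ideal A} [p.IsPrime] {u v : M} (hu : NonBasic p u) (hv : NonBasic p v) :
    NonBasic p (u + v) := by
  obtain ⟨a, ha, hau⟩ := hu
  obtain ⟨b, hb, hbv⟩ := hv
  refine ⟨a * b, fun h => (Ideal.IsPrime.mem_or_mem ‹_› h).elim ha hb, ?_⟩
  rw [smul_add]
  refine add_mem ?_ ?_
  · rw [mul_comm, mul_smul]; exact Submodule.smul_mem _ _ hau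
  · rw [mul_smul]; exact Submodule.smul_mem _ _ hbv

lemma NonBasic.neg {p : Ideal A} {u : M} (hu : NonBasic p u) : NonBasic p (-u) := by
  obtain ⟨a, ha, hau⟩ := hu
  exact ⟨a, ha, by rw [smul_neg]; exact neg_mem hau⟩

lemma NonBasic.of_mem {p : Ideal A} (hp : p ≠ ⊤) {u : M} (hu : u ∈ p • (⊤ : Submodule A M)) :
    NonBasic p u :=
  ⟨1, (Ideal.ne_top_iff_one p).1 hp, by simpa using hu⟩

lemma NonBasic.of_smul {p : Ideal A} [hp : p.IsPrime] {a : A} (ha : a ∉ p) {u : M}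
    (hu : NonBasic p (a • u)) : NonBasic p u := by
  obtain ⟨b, hb, hbu⟩ := hu
  exact ⟨b * a, fun h => (hp.mem_or_mem h).elim hb ha, by rwa [mul_smul]⟩

/-- Passing to the quotient by a basic element drops the local number of generators. -/
lemma LocGenLE.quotient_span_singleton {p : Ideal A} [hp : p.IsPrime] {i : ℕ}
    (h : LocGenLE M p (i + 1)) {u : M} (hu : ¬ NonBasic p u) :
    LocGenLE (M ⧸ Submodule.span A {u}) p i := by
  obtain ⟨a, ha, m, hm⟩ := h
  obtain ⟨c, hc⟩ := (Submodule.mem_span_range_iff_exists_fun A).1 (hm u)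
  have : ∃ l, c l ∉ p := by
    by_contra! hcon
    refine hu ⟨a, ha, ?_⟩
    rw [← hc]
    exact Submodule.sum_mem _ fun l _ => Submodule.smul_mem_smul (hcon l) trivial
  obtain ⟨l, hl⟩ := this
  set π := (Submodule.span A {u}).mkQ with hπ
  refine ⟨c l * a, fun h => (hp.mem_or_mem h).elim hl ha, fun j => π (m (l.succAbove j)), ?_⟩
  set T := Submodule.span A (Set.range fun j => π (m (l.succAbove j))) with hT
  have hother : ∀ j, π (m (l.succAbove j)) ∈ T := fun j => Submodule.subset_span ⟨j, rfl⟩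
  have hpu : π u = 0 := by
    rw [hπ, Submodule.mkQ_apply, Submodule.Quotient.mk_eq_zero]
    exact Submodule.mem_span_singleton_self u
  have hml : c l • π (m l) ∈ T := by
    have := congrArg π hc
    rw [Fin.sum_univ_succAbove _ l, map_add, map_smul, map_smul, hpu, smul_zero, map_sum] at this
    rw [eq_neg_of_add_eq_zero_left this]
    refine neg_mem (Submodule.sum_mem _ fun j _ => ?_)
    rw [map_smul]
    exact Submodule.smul_mem _ _ (hother j)
  intro x
  obtain ⟨x, rfl⟩ := Submodule.mkQ_surjective _ x
  obtain ⟨d, hd⟩ := (Submodule.mem_span_range_iff_exists_fun A).1 (hm x)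
  rw [mul_smul, ← map_smul, ← hd, Fin.sum_univ_succAbove _ l, map_add, smul_add, map_sum]
  refine add_mem ?_ (Submodule.smul_mem _ _ (Submodule.sum_mem _ fun j _ => ?_))
  · rw [map_smul, smul_comm]
    exact Submodule.smul_mem _ _ hml
  · rw [map_smul]
    exact Submodule.smul_mem _ _ (hother j)

lemma exists_not_nonBasic [Module.Finite A M] {p : Ideal A} [hp : p.IsPrime]
    (h : ¬ LocGenLE M p 0) : ∃ u : M, ¬ NonBasic p u := by
  by_contra! hcon
  apply h
  obtain ⟨n, m, hm⟩ := Module.Finite.exists_fin (R := A) (M := M)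
  choose a ha ham using fun l => hcon (m l)
  set b := ∏ l, a l with hb
  have hbp : b ∉ p := by
    rw [hb, hp.prod_mem_iff]
    rintro ⟨l, -, hl⟩
    exact ha l hl
  have hrange : LinearMap.range (LinearMap.lsmul A M b) ≤ p • (⊤ : Submodule A M) := by
    rw [LinearMap.range_eq_map, ← hm, Submodule.map_span_le]
    rintro _ ⟨l, rfl⟩
    rw [hm, LinearMap.lsmul_apply, hb, ← Finset.prod_erase_mul _ _ (Finset.mem_univ l), mul_smul]
    exact Submodule.smul_mem _ _ (ham l)
  obtain ⟨q, hq, -, hqc, hq0⟩ :=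
    LinearMap.exists_monic_and_natDegree_eq_and_coeff_mem_pow_and_aeval_eq_zero
      A (LinearMap.lsmul A M b) p hrange
  have hev : ∀ x : M, (q.eval b) • x = 0 := by
    intro x
    have : Polynomial.aeval (LinearMap.lsmul A M b) q = LinearMap.lsmul A M (q.eval b) := by
      have h1 : LinearMap.lsmul A M b = Algebra.lsmul A A M b := rfl
      rw [h1, Polynomial.aeval_algHom_apply, Polynomial.coe_aeval_eq_eval]
      rfl
    have h2 := LinearMap.congr_fun (this.symm.trans hq0) x
    simpa using h2
  refine ⟨q.eval b, ?_, Fin.elim0, fun x => by rw [hev]; exact zero_mem _⟩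
  intro hmem
  rw [Polynomial.eval_eq_sum_range, Finset.sum_range_succ, Polynomial.coeff_natDegree,
    hq.leadingCoeff, one_mul] at hmem
  have hlow : ∑ i ∈ Finset.range q.natDegree, q.coeff i * b ^ i ∈ p := by
    refine Ideal.sum_mem _ fun i hi => Ideal.mul_mem_right _ _ ?_
    have := hqc i
    exact Ideal.pow_le_self (by have := Finset.mem_range.1 hi; omega) this
  exact hbp (hp.mem_of_pow_mem _ ((Ideal.add_mem_iff_right _ hlow).1 hmem))

/-- Simultaneous choice of a basic element at finitely many primes. -/
lemma exists_forall_not_nonBasic [Module.Finite A M] (S : Finset (Ideal A))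
    (hS : ∀ p ∈ S, p.IsPrime ∧ ¬ LocGenLE M p 0) : ∃ u : M, ∀ p ∈ S, ¬ NonBasic p u := by
  classical
  induction hn : S.card generalizing S with
  | zero => exact ⟨0, by simp [Finset.card_eq_zero.1 hn]⟩
  | succ n ih =>
    obtain ⟨p, hpS, hpmin⟩ := S.exists_minimal (Finset.card_pos.1 (by omega))
    obtain ⟨u, hu⟩ := ih (S.erase p) (fun q hq => hS q (Finset.mem_of_mem_erase hq))
      (by rw [Finset.card_erase_of_mem hpS]; omega)
    by_cases hup : NonBasic p u
    · have := (hS p hpS).1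
      obtain ⟨m, hm⟩ := exists_not_nonBasic (hS p hpS).2
      have hex : ∀ q ∈ S.erase p, ∃ a ∈ q, a ∉ p := by
        intro q hq
        refine Set.not_subset.1 fun hle => (Finset.ne_of_mem_erase hq) (le_antisymm hle ?_)
        exact hpmin (Finset.mem_of_mem_erase hq) hle
      choose! a haq hap using hex
      set b := ∏ q ∈ S.erase p, a q with hb
      have hbp : b ∉ p := by
        rw [hb, Ideal.IsPrime.prod_mem_iff]
        rintro ⟨q, hq, hqa⟩
        exact hap q hq hqa
      refine ⟨u + b • m, fun q hq hcon => ?_⟩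
      by_cases hqp : q = p
      · subst hqp
        refine hm (NonBasic.of_smul hbp ?_)
        simpa using hcon.add hup.neg
      · have hq' : q ∈ S.erase p := Finset.mem_erase.2 ⟨hqp, hq⟩
        have := (hS q hq).1
        refine hu q hq' ?_
        have hbq : NonBasic q (-(b • m)) :=
          (NonBasic.of_mem this.ne_top (Submodule.smul_mem_smul
            (Ideal.mem_of_dvd q (Finset.dvd_prod_of_mem a hq') (haq q hq')) trivial)).neg
        simpa using hcon.add hbq
    · refine ⟨u, fun q hq => ?_⟩
      by_cases hqp : q = p
      · rwa [hqp]
      · exact hu q (Finset.mem_erase.2 ⟨hqp, hq⟩)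

variable (A M) in
lemma finite_minimalPrimes_locGenIdeal [IsNoetherianRing A] (i : ℕ) :
    (locGenIdeal A M i).minimalPrimes.Finite :=
  Ideal.finite_minimalPrimes_of_isNoetherianRing A _

lemma subsingleton_of_locGenLE_zero (h : ∀ p : Ideal A, p.IsMaximal → LocGenLE M p 0) :
    Subsingleton M := by
  have htop : locGenIdeal A M 0 = ⊤ := by
    by_contra hne
    obtain ⟨p, hp, hle⟩ := Ideal.exists_le_maximal _ hne
    exact locGenLE_iff.1 (h p hp) hle
  have hle : locGenIdeal A M 0 ≤ Module.annihilator A M := by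
    rw [locGenIdeal, Ideal.span_le]
    rintro a ⟨m, hm⟩
    rw [SetLike.mem_coe, Module.mem_annihilator]
    intro x
    simpa [Set.range_eq_empty] using hm x
  rw [htop, top_le_iff] at hle
  refine ⟨fun x y => ?_⟩
  have h1 : (1 : A) ∈ Module.annihilator A M := hle ▸ trivial
  rw [Module.mem_annihilator] at h1
  rw [← one_smul A x, ← one_smul A y, h1, h1]

lemma isPrime_and_not_locGenLE {i : ℕ} {p : Ideal A} (hp : p ∈ (locGenIdeal A M i).minimalPrimes) :
    p.IsPrime ∧ ¬ LocGenLE M p i :=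
  ⟨hp.1.1, fun h => locGenLE_iff.1 h hp.1.2⟩

lemma exists_minimalPrimes_le_of_not_locGenLE {i : ℕ} {p : Ideal A} [p.IsPrime]
    (h : ¬ LocGenLE M p i) : ∃ q ∈ (locGenIdeal A M i).minimalPrimes, q ≤ p :=
  Ideal.exists_minimalPrimes_le (not_not.1 (mt locGenLE_iff.2 h))

lemma exists_span_singleton_eq_top [IsNoetherianRing A] [Module.Finite A M]
    (h0 : ∀ p : Ideal A, p.IsPrime → ¬ p.IsMaximal → LocGenLE M p 0)
    (h1 : ∀ p : Ideal A, p.IsPrime → LocGenLE M p 1) :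
    ∃ v : M, Submodule.span A {v} = ⊤ := by
  obtain ⟨v, hv⟩ := exists_forall_not_nonBasic (M := M)
    (finite_minimalPrimes_locGenIdeal A M 0).toFinset
    (fun p hp => isPrime_and_not_locGenLE ((Set.Finite.mem_toFinset _).1 hp))
  simp only [Set.Finite.mem_toFinset] at hv
  refine ⟨v, Submodule.Quotient.subsingleton_iff.1
    (subsingleton_of_locGenLE_zero (A := A) fun p hpm => ?_)⟩
  have := hpm.isPrime
  by_cases h : LocGenLE M p 0
  · exact h.of_surjective _ (Submodule.mkQ_surjective _)
  · obtain ⟨q, hq, hqp⟩ := exists_minimalPrimes_le_of_not_locGenLE h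
    have hqm : q.IsMaximal := by
      by_contra hqm
      exact (isPrime_and_not_locGenLE hq).2 (h0 q (isPrime_and_not_locGenLE hq).1 hqm)
    obtain rfl := hqm.eq_of_le hpm.ne_top hqp
    exact (h1 q this).quotient_span_singleton (hv q hq)

/-- A case of the Forster–Swan theorem for modules with one-dimensional support. -/
lemma exists_pair_span_eq_top [IsNoetherianRing A] [Module.Finite A M]
    (ha : ∀ q p : Ideal A, q.IsPrime → p.IsPrime → q < p → ¬ LocGenLE M q 0 → p.IsMaximal)
    (hb : ∀ p : Ideal A, p.IsPrime → ¬ p.IsMaximal → LocGenLE M p 1)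
    (hc : ∀ p : Ideal A, p.IsPrime → LocGenLE M p 2) :
    ∃ u v : M, Submodule.span A {u, v} = ⊤ := by
  classical
  obtain ⟨u, hu⟩ := exists_forall_not_nonBasic (M := M)
    ((finite_minimalPrimes_locGenIdeal A M 0).toFinset ∪
      (finite_minimalPrimes_locGenIdeal A M 1).toFinset) (by
      intro p hp
      rw [Finset.mem_union, Set.Finite.mem_toFinset, Set.Finite.mem_toFinset] at hp
      rcases hp with hp | hp
      · exact isPrime_and_not_locGenLE hp
      · exact ⟨(isPrime_and_not_locGenLE hp).1,
          fun h => (isPrime_and_not_locGenLE hp).2 (h.mono zero_le_one)⟩)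
  simp only [Finset.mem_union, Set.Finite.mem_toFinset] at hu
  obtain ⟨v, hv⟩ := exists_span_singleton_eq_top (A := A) (M := M ⧸ Submodule.span A {u}) (by
    intro p hp hpm
    by_cases h : LocGenLE M p 0
    · exact h.of_surjective _ (Submodule.mkQ_surjective _)
    · obtain ⟨q, hq, hqp⟩ := exists_minimalPrimes_le_of_not_locGenLE h
      rcases hqp.lt_or_eq with hlt | rfl
      · exact absurd (ha q p (isPrime_and_not_locGenLE hq).1 hp hlt
          (isPrime_and_not_locGenLE hq).2) hpm
      · exact (hb q hp hpm).quotient_span_singleton (hu q (Or.inl hq))) (by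
    intro p hp
    by_cases h : LocGenLE M p 1
    · exact h.of_surjective _ (Submodule.mkQ_surjective _)
    · obtain ⟨q, hq, hqp⟩ := exists_minimalPrimes_le_of_not_locGenLE h
      have hqm : q.IsMaximal := by
        by_contra hqm
        exact (isPrime_and_not_locGenLE hq).2 (hb q (isPrime_and_not_locGenLE hq).1 hqm)
      obtain rfl := hqm.eq_of_le hp.ne_top hqp
      exact (hc q hp).quotient_span_singleton (hu q (Or.inr hq)))
  obtain ⟨v, rfl⟩ := Submodule.mkQ_surjective _ v
  refine ⟨u, v, ?_⟩
  have h4 : Submodule.comap (Submodule.span A {u}).mkQ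
      (Submodule.map (Submodule.span A {u}).mkQ (Submodule.span A {v})) = ⊤ := by
    rw [Submodule.map_span, Set.image_singleton, hv, Submodule.comap_top]
  rwa [Submodule.comap_map_mkQ, ← Submodule.span_union, Set.singleton_union] at h4

end LocalGeneration

section Homotopy

variable {D : Type*} [CommRing D]

lemma sub_comp_dvd_comp_sub_comp (g p q : D[X]) : p - q ∣ g.comp p - g.comp q := by
  simpa only [Polynomial.comp, Polynomial.eval₂_eq_eval_map] using
    Polynomial.sub_dvd_eval_sub p q (g.map Polynomial.C)

/-- If a finitely generated ideal `I` of `D[X]` agrees with a subideal `J` up to `j I`, where `j`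
is a constant of `I`, and if `J` contains a monic polynomial with a value dividing `j`, then `I` is
obtained from `J` by a substitution. -/
lemma exists_map_eq_of_le_sup_mul [IsNoetherianRing D] {I J : Ideal D[X]} (hJI : J ≤ I)
    {j b : D} (hj : Polynomial.C j ∈ I) (hIJ : I ≤ J ⊔ Ideal.span {Polynomial.C j} * I)
    {f : D[X]} (hf : f.Monic) (hfJ : f ∈ J) (hb : f.eval b ∣ j) :
    ∃ φ : D[X] →+* D[X], J.map φ = I := by
  have hfin : Module.Finite D (D[X] ⧸ J) := by
    have := hf.finite_quotient
    have hle : Ideal.span {f} ≤ J := (Ideal.span_singleton_le_iff_mem _).2 hfJ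
    exact Module.Finite.of_surjective (Ideal.Quotient.factorₐ D hle).toLinearMap
      (Ideal.Quotient.factor_surjective hle)
  obtain ⟨s, hs1, hs⟩ := Submodule.exists_sub_one_mem_and_smul_eq_zero_of_fg_of_le_smul
    (Ideal.span {j}) ((I.restrictScalars D).map (Ideal.Quotient.mkₐ D J).toLinearMap)
    (IsNoetherian.noetherian _) (by
      rintro _ ⟨x, hx, rfl⟩
      obtain ⟨y, hy, z, hz, rfl⟩ := Submodule.mem_sup.1 (hIJ hx)
      obtain ⟨z, hzI, rfl⟩ := Ideal.mem_span_singleton_mul.1 hz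
      rw [map_add]
      have hy0 : (Ideal.Quotient.mkₐ D J).toLinearMap y = 0 := Ideal.Quotient.eq_zero_iff_mem.2 hy
      rw [hy0, zero_add, ← Polynomial.smul_eq_C_mul, map_smul]
      exact Submodule.smul_mem_smul (Ideal.mem_span_singleton_self j)
        (Submodule.mem_map_of_mem hzI))
  have hsI : ∀ x ∈ I, Polynomial.C s * x ∈ J := by
    intro x hx
    have := hs _ (Submodule.mem_map_of_mem (p := I.restrictScalars D) hx)
    rw [← map_smul, Polynomial.smul_eq_C_mul] at this
    exact Ideal.Quotient.eq_zero_iff_mem.1 this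
  obtain ⟨t, ht⟩ := Ideal.mem_span_singleton.1 hs1
  set c : D[X] := Polynomial.C s * Polynomial.X + Polynomial.C ((1 - s) * b) with hc
  have hφC : ∀ d : D, Polynomial.compRingHom c (Polynomial.C d) = Polynomial.C d := by simp
  set K := J.map (Polynomial.compRingHom c) with hK
  have hφ : ∀ x ∈ J, Polynomial.compRingHom c x ∈ K := fun x hx => Ideal.mem_map_of_mem _ hx
  have hs' : 1 - Polynomial.C s = Polynomial.C j * -Polynomial.C t := by
    rw [mul_neg, ← Polynomial.C_mul, ← ht]; simp
  have hX : ∀ g : D[X], ∃ y, g - g.comp c = (1 - Polynomial.C s) * y := by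
    intro g
    obtain ⟨y, hy⟩ := sub_comp_dvd_comp_sub_comp g Polynomial.X c
    rw [Polynomial.comp_X] at hy
    refine ⟨(Polynomial.X - Polynomial.C b) * y, ?_⟩
    rw [hy, hc]
    simp only [Polynomial.C_mul, Polynomial.C_sub, Polynomial.C_1]
    ring
  have hsj : Polynomial.C s * Polynomial.C j ∈ K := by
    have := hφ _ (hsI _ hj)
    rwa [map_mul, hφC, hφC] at this
  have hjf : Polynomial.C j * Polynomial.C (f.eval b) ∈ K := by
    obtain ⟨y, hy⟩ := sub_comp_dvd_comp_sub_comp f c (Polynomial.C b)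
    rw [Polynomial.comp_C] at hy
    have h1 : Polynomial.C j * Polynomial.C (f.eval b) = Polynomial.C j * f.comp c
        - (Polynomial.C s * Polynomial.C j) * ((Polynomial.X - Polynomial.C b) * y) := by
      have h2 : Polynomial.C (f.eval b) = f.comp c - (c - Polynomial.C b) * y := by
        rw [← hy]; ring
      rw [h2, hc]
      simp only [Polynomial.C_mul, Polynomial.C_sub, Polynomial.C_1]
      ring
    rw [h1]
    exact sub_mem (Ideal.mul_mem_left _ _ (hφ f hfJ)) (Ideal.mul_mem_right _ _ hsj)
  have hjj : Polynomial.C j * Polynomial.C j ∈ K := by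
    obtain ⟨e, he⟩ := hb
    nth_rewrite 2 [he]
    rw [Polynomial.C_mul, ← mul_assoc]
    exact Ideal.mul_mem_right _ _ hjf
  refine ⟨Polynomial.compRingHom c, le_antisymm (Ideal.map_le_iff_le_comap.2 fun g hg => ?_)
    fun x hx => ?_⟩
  · obtain ⟨y, hy⟩ := hX g
    rw [Ideal.mem_comap, Polynomial.coe_compRingHom_apply,
      show g.comp c = g - (1 - Polynomial.C s) * y by rw [← hy]; ring, hs', mul_assoc]
    exact sub_mem (hJI hg) (Ideal.mul_mem_right _ _ hj)
  · have hsx : Polynomial.C s * x ∈ K := by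
      obtain ⟨y, hy⟩ := hX x
      have h1 := hφ _ (hsI x hx)
      rw [map_mul, hφC, Polynomial.coe_compRingHom_apply] at h1
      have h2 : Polynomial.C s * x = Polynomial.C s * x.comp c
          + (Polynomial.C s * Polynomial.C j) * (-Polynomial.C t * y) := by
        linear_combination Polynomial.C s * hy + Polynomial.C s * y * hs'
      rw [h2]
      exact add_mem h1 (Ideal.mul_mem_right _ _ hsj)
    have h3 : x = Polynomial.C s * (Polynomial.C s * x) +
        (Polynomial.C s * Polynomial.C j) * (-2 * Polynomial.C t * x) +
        (Polynomial.C j * Polynomial.C j) * (Polynomial.C t * Polynomial.C t * x) := by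
      linear_combination x * (1 + Polynomial.C s - Polynomial.C j * Polynomial.C t) * hs'
    rw [h3]
    exact add_mem (add_mem (Ideal.mul_mem_left _ _ hsx) (Ideal.mul_mem_right _ _ hsj))
      (Ideal.mul_mem_right _ _ hjj)

end Homotopy

section MonicChange

variable {k : Type*} [Field k] {n : ℕ}

/-- The algebra map fixing `X₀` and sending `Xᵢ` to `Xᵢ + c X₀ ^ (u ^ i)` for `i ≠ 0`. -/
noncomputable def powerShift (n u : ℕ) (c : k) :
    MvPolynomial (Fin (n + 1)) k →ₐ[k] MvPolynomial (Fin (n + 1)) k :=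
  MvPolynomial.aeval fun i => if i = 0 then MvPolynomial.X 0
    else MvPolynomial.X i + c • MvPolynomial.X 0 ^ u ^ i.1

lemma powerShift_comp_neg (u : ℕ) (c : k) :
    (powerShift n u c).comp (powerShift n u (-c)) = AlgHom.id k _ := by
  rw [powerShift, powerShift, MvPolynomial.comp_aeval, ← MvPolynomial.aeval_X_left]
  ext i v
  cases i using Fin.cases <;> simp

/-- `powerShift` with coefficient one as an automorphism. -/
noncomputable def powerShiftEquiv (k : Type*) [Field k] (n u : ℕ) :
    MvPolynomial (Fin (n + 1)) k ≃ₐ[k] MvPolynomial (Fin (n + 1)) k :=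
  AlgEquiv.ofAlgHom (powerShift n u 1) (powerShift n u (-1))
    (powerShift_comp_neg u 1) (by simpa using powerShift_comp_neg (n := n) u (-1 : k))

lemma finSuccEquiv_powerShiftEquiv_X_zero (u : ℕ) :
    MvPolynomial.finSuccEquiv k n (powerShiftEquiv k n u (MvPolynomial.X 0)) = Polynomial.X := by
  simp [powerShiftEquiv, powerShift, finSuccEquiv_X_zero]

lemma finSuccEquiv_powerShiftEquiv_X_succ (u : ℕ) (i : Fin n) :
    MvPolynomial.finSuccEquiv k n (powerShiftEquiv k n u (MvPolynomial.X i.succ)) =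
      Polynomial.X ^ u ^ (i.1 + 1) + Polynomial.C (MvPolynomial.X i) := by
  simp [powerShiftEquiv, powerShift, finSuccEquiv_X_zero, finSuccEquiv_X_succ, add_comm]

lemma finSuccEquiv_powerShiftEquiv_monomial (u : ℕ) (hu : 0 < u) (v : Fin (n + 1) →₀ ℕ) (a : k)
    (ha : a ≠ 0) :
    (finSuccEquiv k n (powerShiftEquiv k n u (MvPolynomial.monomial v a))).natDegree =
        ∑ i, u ^ i.1 * v i ∧
      (finSuccEquiv k n (powerShiftEquiv k n u (MvPolynomial.monomial v a))).leadingCoeff =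
        MvPolynomial.C a := by
  have hmon : ∀ i : Fin n, (Polynomial.X ^ u ^ (i.1 + 1) +
      Polynomial.C (MvPolynomial.X i : MvPolynomial (Fin n) k)).Monic :=
    fun i => Polynomial.monic_X_pow_add_C _ (pow_ne_zero _ hu.ne')
  have key : finSuccEquiv k n (powerShiftEquiv k n u (MvPolynomial.monomial v a)) =
      Polynomial.C (MvPolynomial.C a) * (Polynomial.X ^ v 0 * ∏ i : Fin n,
        (Polynomial.X ^ u ^ (i.1 + 1) + Polynomial.C (MvPolynomial.X i)) ^ v i.succ) := by
    have hC : powerShiftEquiv k n u (MvPolynomial.C a) = MvPolynomial.C a :=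
      (powerShiftEquiv k n u).commutes a
    rw [MvPolynomial.monomial_eq, Finsupp.prod_fintype _ _ (fun i => pow_zero _), map_mul, map_mul,
      map_prod, map_prod, Fin.prod_univ_succ, hC]
    simp only [map_pow, finSuccEquiv_powerShiftEquiv_X_zero, finSuccEquiv_powerShiftEquiv_X_succ]
    congr 1
    simp [finSuccEquiv_apply]
  have hprod : (Polynomial.X ^ v 0 * ∏ i : Fin n, (Polynomial.X ^ u ^ (i.1 + 1) +
      Polynomial.C (MvPolynomial.X i : MvPolynomial (Fin n) k)) ^ v i.succ).Monic :=
    (Polynomial.monic_X_pow _).mul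
      (Polynomial.monic_prod_of_monic _ _ fun i _ => (hmon i).pow _)
  have hCa : (MvPolynomial.C a : MvPolynomial (Fin n) k) ≠ 0 := by simpa using ha
  rw [key]
  constructor
  · rw [Polynomial.natDegree_C_mul hCa, (Polynomial.monic_X_pow _).natDegree_mul
      (Polynomial.monic_prod_of_monic _ _ fun i _ => (hmon i).pow _), Polynomial.natDegree_X_pow,
      Polynomial.natDegree_prod_of_monic _ _ fun i _ => (hmon i).pow _, Fin.sum_univ_succ]
    simp only [(hmon _).natDegree_pow, Polynomial.natDegree_X_pow_add_C]
    simp [mul_comm]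
  · rw [Polynomial.leadingCoeff_mul, hprod.leadingCoeff, mul_one, Polynomial.leadingCoeff_C]

lemma sum_pow_mul_ne {u : ℕ} {v w : Fin (n + 1) →₀ ℕ} (hv : ∀ i, v i < u)
    (hw : ∀ i, w i < u) (h1 : 1 < u) (h : v ≠ w) :
    ∑ i, u ^ i.1 * v i ≠ ∑ i, u ^ i.1 * w i := by
  intro heq
  refine h (Finsupp.ext (congrFun (List.ofFn_inj.mp ?_)))
  apply Nat.ofDigits_inj_of_len_eq h1 (by simp)
    (by simpa [List.mem_ofFn] using ⟨hv 0, fun a => hv a.succ⟩)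
    (by simpa [List.mem_ofFn] using ⟨hw 0, fun a => hw a.succ⟩)
  simpa only [Nat.ofDigits_eq_sum_mapIdx, List.mapIdx_eq_ofFn, List.get_ofFn, List.length_ofFn,
    Fin.val_cast, mul_comm, List.sum_ofFn] using! heq

/-- A nonzero polynomial becomes monic in the first variable, up to a unit, after a suitable change
of variables. -/
lemma exists_equiv_isUnit_leadingCoeff {f : MvPolynomial (Fin (n + 1)) k} (hf : f ≠ 0) :
    ∃ e : MvPolynomial (Fin (n + 1)) k ≃+* Polynomial (MvPolynomial (Fin n) k),
      IsUnit (e f).leadingCoeff := by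
  set u := 2 + f.totalDegree with hu
  set e := (powerShiftEquiv k n u).trans (finSuccEquiv k n) with he
  have hlt : ∀ v ∈ f.support, ∀ i, v i < u := fun v hv i => by
    have := (monomial_le_degreeOf i hv).trans (degreeOf_le_totalDegree f i)
    omega
  set h := fun w => MvPolynomial.monomial w (MvPolynomial.coeff w f) with hh
  have hmon := fun v (hv : v ∈ f.support) =>
    finSuccEquiv_powerShiftEquiv_monomial u (by omega) v _ (MvPolynomial.mem_support_iff.1 hv)
  obtain ⟨v, hv, hmax⟩ := Finset.exists_max_image f.support
    (fun v => ∑ i, u ^ i.1 * v i) (support_nonempty.mpr hf)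
  refine ⟨e.toRingEquiv, ?_⟩
  have hlead : (e (h v + ∑ x ∈ f.support \ {v}, h x)).leadingCoeff = (e (h v)).leadingCoeff := by
    rw [map_add, map_sum, add_comm]
    apply Polynomial.leadingCoeff_add_of_degree_lt
    refine (Polynomial.degree_sum_le _ _).trans_lt ?_
    have h0 : e (h v) ≠ 0 := by
      have : h v ≠ 0 := by simpa [hh] using MvPolynomial.mem_support_iff.1 hv
      simpa using this
    refine (Finset.sup_lt_iff (Ne.bot_lt fun hx => h0 (Polynomial.degree_eq_bot.1 hx))).2 ?_
    intro x hx
    obtain ⟨hx1, hx2⟩ := Finset.mem_sdiff.1 hx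
    apply Polynomial.degree_lt_degree
    have e1 : (e (h x)).natDegree = _ := (hmon x hx1).1
    have e2 : (e (h v)).natDegree = _ := (hmon v hv).1
    rw [e1, e2]
    exact lt_of_le_of_ne (hmax x hx1) (sum_pow_mul_ne (hlt x hx1) (hlt v hv) (by omega)
      (by simpa using hx2))
  have hf' : h v + ∑ x ∈ f.support \ {v}, h x = f := by
    rw [← Finset.sum_eq_add_sum_sdiff_singleton_of_mem hv h, hh, f.support_sum_monomial_coeff]
  rw [hf'] at hlead
  have e3 : (e (h v)).leadingCoeff = _ := (hmon v hv).2
  change IsUnit (e f).leadingCoeff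
  rw [hlead, e3]
  exact (MvPolynomial.mem_support_iff.1 hv).isUnit.map MvPolynomial.C

end MonicChange

section Dimension

lemma height_le_one_of_comap_C_eq_bot {D : Type*} [CommRing D] [IsDomain D] (P : Ideal D[X])
    [P.IsPrime] (hP : P.comap Polynomial.C = ⊥) : P.height ≤ 1 := by
  let K := FractionRing D
  let _ : Algebra D[X] K[X] := Polynomial.algebra D K
  have := Polynomial.isLocalization (nonZeroDivisors D) K
  have hdis : Disjoint
      (((nonZeroDivisors D).map (Polynomial.C : D →+* D[X]) : Submonoid D[X]) : Set D[X])
      (P : Set D[X]) := by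
    rw [Set.disjoint_left]
    rintro _ ⟨d, hd, rfl⟩ hdP
    have : d ∈ P.comap Polynomial.C := hdP
    rw [hP, Ideal.mem_bot] at this
    exact nonZeroDivisors.ne_zero hd this
  rw [← IsLocalization.height_map_of_disjoint (S := K[X])
    ((nonZeroDivisors D).map (Polynomial.C : D →+* D[X])) P hdis]
  have : (P.map (algebraMap D[X] K[X])).IsPrime :=
    IsLocalization.isPrime_of_isPrime_disjoint _ _ P ‹_› hdis
  refine Ideal.height_le_one_of_isPrincipal_of_mem_minimalPrimes (P.map (algebraMap D[X] K[X])) _ ?_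
  rw [Ideal.minimalPrimes_eq_subsingleton_self]
  rfl

lemma height_add_one_le_of_lt {A : Type*} [CommRing A] {p q : Ideal A} [p.IsPrime] [q.IsPrime]
    (h : p < q) : p.height + 1 ≤ q.height := by
  have h1 : p.height = _ := PrimeSpectrum.height_eq_orderHeight ⟨p, ‹_›⟩
  have h2 : q.height = _ := PrimeSpectrum.height_eq_orderHeight ⟨q, ‹_›⟩
  rw [h1, h2]
  exact Order.height_add_one_le h

lemma two_le_height {D : Type*} [CommRing D] [IsDomain D] (q : Ideal D[X]) [q.IsPrime]
    {f : D[X]} (hf : f.Monic) (hfq : f ∈ q) {j : D} (hj : j ≠ 0) (hjq : Polynomial.C j ∈ q) :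
    2 ≤ q.height := by
  have hle : (q.comap Polynomial.C).map Polynomial.C ≤ q := Ideal.map_comap_le
  have h1 : (⊥ : Ideal D[X]) < (q.comap Polynomial.C).map Polynomial.C := by
    refine bot_lt_iff_ne_bot.2 fun h => hj ?_
    have : Polynomial.C j ∈ (q.comap Polynomial.C).map Polynomial.C :=
      Ideal.mem_map_of_mem _ hjq
    rw [h, Ideal.mem_bot] at this
    simpa using this
  have h2 : (q.comap Polynomial.C).map Polynomial.C < q := by
    refine lt_of_le_of_ne hle fun h => ?_
    rw [← h, Ideal.mem_map_C_iff] at hfq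
    have h3 := hfq f.natDegree
    rw [hf.coeff_natDegree, Ideal.mem_comap, map_one] at h3
    exact Ideal.IsPrime.ne_top ‹_› ((Ideal.eq_top_iff_one q).2 h3)
  have h4 : ((q.comap Polynomial.C).map Polynomial.C).IsPrime :=
    Ideal.isPrime_map_C_of_isPrime
  have h5 : (⊥ : Ideal D[X]).IsPrime := Ideal.isPrime_bot
  have h6 := height_add_one_le_of_lt h1
  have h7 := height_add_one_le_of_lt h2
  calc (2 : ℕ∞) ≤ (⊥ : Ideal D[X]).height + 1 + 1 := by
        rw [add_assoc, one_add_one_eq_two]; exact le_add_self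
    _ ≤ _ := (add_le_add_left h6 1).trans h7

lemma isMaximal_of_three_le_height {A : Type*} [CommRing A] (hA : ringKrullDim A ≤ 3)
    (p : Ideal A) [hp : p.IsPrime] (h : 3 ≤ p.height) : p.IsMaximal := by
  obtain ⟨m, hm, hle⟩ := Ideal.exists_le_maximal p hp.ne_top
  rcases hle.lt_or_eq with hlt | rfl
  · exfalso
    have := hm.isPrime
    have h1 := height_add_one_le_of_lt hlt
    have h2 : (m.height : WithBot ℕ∞) ≤ 3 :=
      (Ideal.height_le_ringKrullDim_of_ne_top hm.ne_top).trans hA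
    have h3 : m.height ≤ 3 := by exact (WithBot.coe_le_coe (a := m.height) (b := 3)).1 h2
    have h4 : (3 + 1 : ℕ∞) ≤ 3 := (add_le_add_left h 1).trans (h1.trans h3)
    exact absurd h4 (by decide)
  · exact hm

lemma ringKrullDim_mvPolynomial (k : Type*) [Field k] (n : ℕ) :
    ringKrullDim (MvPolynomial (Fin n) k) = n := by
  rw [MvPolynomial.ringKrullDim_of_isNoetherianRing]
  simp

lemma height_eq_of_idealHeight {A : Type*} [CommRing A] (p : Ideal A) [p.IsPrime] :
    p.height = ⨅ P : {P : PrimeSpectrum A // p ≤ P.asIdeal}, Order.height P.1 := by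
  have h1 : p.height = _ := PrimeSpectrum.height_eq_orderHeight ⟨p, ‹_›⟩
  rw [h1]
  refine le_antisymm (le_iInf fun P => Order.height_mono P.2) ?_
  exact iInf_le_of_le ⟨⟨p, ‹_›⟩, le_rfl⟩ le_rfl

end Dimension

section ThreeGenerators

lemma locGenLE_one_of_not_le {A : Type*} [CommRing A] {I p : Ideal A} (h : ¬ I ≤ p) :
    LocGenLE I p 1 := by
  obtain ⟨a, haI, hap⟩ := Set.not_subset.1 h
  refine ⟨a, hap, fun _ => ⟨a, haI⟩, fun x => ?_⟩
  have : a • x = x.1 • (⟨a, haI⟩ : I) := Subtype.ext (mul_comm _ _)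
  rw [this]
  exact Submodule.smul_mem _ _ (Submodule.subset_span ⟨0, rfl⟩)

lemma not_locGenLE_zero {A : Type*} [CommRing A] [IsDomain A] {I p : Ideal A} (h : I ≠ ⊥) :
    ¬ LocGenLE I p 0 := by
  rintro ⟨a, hap, m, hm⟩
  obtain ⟨x, hxI, hx⟩ := Submodule.exists_mem_ne_zero_of_ne_bot h
  have := hm ⟨x, hxI⟩
  rw [Set.range_eq_empty, Submodule.span_empty, Submodule.mem_bot] at this
  have h2 : a * x = 0 := congrArg Subtype.val this
  rcases mul_eq_zero.1 h2 with rfl | h3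
  · exact hap (zero_mem _)
  · exact hx h3

variable {D : Type*} [CommRing D] [IsDomain D]

lemma three_le_height_of_lt {q p : Ideal D[X]} [q.IsPrime] [p.IsPrime] (hqp : q < p)
    {f : D[X]} (hf : f.Monic) (hfq : f ∈ q) {j : D} (hj : j ≠ 0) (hjq : Polynomial.C j ∈ q) :
    3 ≤ p.height :=
  calc (3 : ℕ∞) = 2 + 1 := by norm_num
    _ ≤ q.height + 1 := add_le_add_left (two_le_height q hf hfq hj hjq) 1
    _ ≤ _ := height_add_one_le_of_lt hqp

/-- A generator of `I`, monic in `X`, which is basic at the primes that matter. -/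
lemma exists_monic_basic [IsNoetherianRing D] {I : Ideal D[X]} {h : D[X]} (hm : h.Monic)
    (hI : h ∈ I) (S : Finset (Ideal D[X])) (hS : ∀ p ∈ S, p.IsPrime ∧ I ≤ p) :
    ∃ f : I, f.1.Monic ∧ ∀ p ∈ S, ¬ NonBasic p f := by
  have hI0 : I ≠ ⊥ := fun h0 => hm.ne_zero (by rw [h0] at hI; simpa using hI)
  obtain ⟨u, hu⟩ := exists_forall_not_nonBasic (M := I) S
    fun p hp => ⟨(hS p hp).1, not_locGenLE_zero hI0⟩
  have hhX : (h * Polynomial.X).Monic := hm.mul Polynomial.monic_X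
  set g : D[X] := (h * Polynomial.X) ^ (u.1.natDegree + 1) * h with hg
  have hgm : g.Monic := (hhX.pow _).mul hm
  have hgI : g ∈ I := Ideal.mul_mem_left _ _ hI
  refine ⟨u + ⟨g, hgI⟩, ?_, fun p hp hcon => hu p hp ?_⟩
  · refine Polynomial.Monic.add_of_right hgm (Polynomial.degree_lt_degree ?_)
    change u.1.natDegree < g.natDegree
    rw [hg, (hhX.pow _).natDegree_mul hm, hhX.natDegree_pow, hm.natDegree_mul Polynomial.monic_X,
      Polynomial.natDegree_X]
    nlinarith
  · have := (hS p hp).1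
    have h1 : NonBasic p (-(⟨g, hgI⟩ : I)) := by
      refine (NonBasic.of_mem this.ne_top ?_).neg
      have h2 : (⟨g, hgI⟩ : I) = (h * Polynomial.X) ^ (u.1.natDegree + 1) • (⟨h, hI⟩ : I) :=
        Subtype.ext (by simp [hg])
      rw [h2]
      refine Submodule.smul_mem_smul ?_ trivial
      exact Ideal.pow_mem_of_mem _ (Ideal.mul_mem_right _ _ ((hS p hp).2 hI)) _ (by omega)
    simpa using hcon.add h1

lemma exists_span_three_of_monic [IsNoetherianRing D] [Infinite D]
    (hdim : ringKrullDim D[X] ≤ 3) {I : Ideal D[X]} {h : D[X]} (hm : h.Monic)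
    (hI : h ∈ I) {j₀ : D} (hj₀ : j₀ ≠ 0) (hjI : Polynomial.C j₀ ∈ I)
    (h2 : ∀ p : Ideal D[X], p.IsPrime → ¬ p.IsMaximal → LocGenLE I p 2)
    (h3 : ∀ p : Ideal D[X], p.IsMaximal → LocGenLE I p 3) :
    ∃ f : Fin 3 → D[X], Ideal.span (Set.range f) = I := by
  classical
  have hE2 : ∀ p ∈ (locGenIdeal D[X] I 2).minimalPrimes, p.IsMaximal := fun p hp => by
    by_contra hpm
    exact (isPrime_and_not_locGenLE hp).2 (h2 p (isPrime_and_not_locGenLE hp).1 hpm)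
  obtain ⟨f, hfm, hf⟩ := exists_monic_basic hm hI
    ((Ideal.finite_minimalPrimes_of_isNoetherianRing D[X] I).toFinset ∪
      (finite_minimalPrimes_locGenIdeal D[X] I 2).toFinset) (by
    intro p hp
    rw [Finset.mem_union, Set.Finite.mem_toFinset, Set.Finite.mem_toFinset] at hp
    rcases hp with hp | hp
    · exact hp.1
    · obtain ⟨h4, h5⟩ := isPrime_and_not_locGenLE hp
      exact ⟨h4, not_not.1 fun h6 => h5 ((locGenLE_one_of_not_le h6).mono one_le_two)⟩)
  simp only [Finset.mem_union, Set.Finite.mem_toFinset] at hf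
  obtain ⟨b, hb⟩ : ∃ b, f.1.eval b ≠ 0 := by
    by_contra! hcon
    exact hfm.ne_zero (Polynomial.funext (by simpa using hcon))
  set j := j₀ * f.1.eval b with hj
  have hj0 : j ≠ 0 := mul_ne_zero hj₀ hb
  have hjI' : Polynomial.C j ∈ I := by
    rw [hj, Polynomial.C_mul]
    exact Ideal.mul_mem_right _ _ hjI
  set N : Submodule D[X] I := Submodule.span D[X] {f} ⊔
    LinearMap.range (LinearMap.lsmul D[X] I (Polynomial.C j)) with hN
  have hsub : ∀ p : Ideal D[X], p.IsPrime → ∀ i, LocGenLE (I ⧸ Submodule.span D[X] {f}) p i →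
      LocGenLE (I ⧸ N) p i := fun p _ i hp =>
    hp.of_surjective (Submodule.factor le_sup_left) (Submodule.factor_surjective _)
  have hsupp : ∀ q : Ideal D[X], ¬ LocGenLE (I ⧸ N) q 0 → f.1 ∈ q ∧ Polynomial.C j ∈ q := by
    intro q hq
    constructor
    · by_contra hfq
      refine hq ⟨f.1, hfq, Fin.elim0, fun x => ?_⟩
      obtain ⟨x, rfl⟩ := Submodule.mkQ_surjective _ x
      have h7 : f.1 • x = x.1 • f := Subtype.ext (mul_comm _ _)
      rw [← map_smul, h7]
      have : N.mkQ (x.1 • f) = 0 := (Submodule.Quotient.mk_eq_zero _).2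
        (Submodule.mem_sup_left (Submodule.smul_mem _ _ (Submodule.mem_span_singleton_self f)))
      rw [this]; exact zero_mem _
    · by_contra hjq
      refine hq ⟨Polynomial.C j, hjq, Fin.elim0, fun x => ?_⟩
      obtain ⟨x, rfl⟩ := Submodule.mkQ_surjective _ x
      rw [← map_smul]
      have : N.mkQ (Polynomial.C j • x) = 0 := (Submodule.Quotient.mk_eq_zero _).2
        (Submodule.mem_sup_right ⟨x, rfl⟩)
      rw [this]; exact zero_mem _
  obtain ⟨u, v, huv⟩ := exists_pair_span_eq_top (A := D[X]) (M := I ⧸ N)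
    (by
      intro q p hq hp hqp hqN
      obtain ⟨h7, h8⟩ := hsupp q hqN
      exact isMaximal_of_three_le_height hdim p (three_le_height_of_lt hqp hfm h7 hj0 h8))
    (by
      intro p hp hpm
      by_cases hIp : I ≤ p
      · obtain ⟨q, hq, hqp⟩ := Ideal.exists_minimalPrimes_le hIp
        rcases hqp.lt_or_eq with hlt | rfl
        · have := hq.1.1
          exact absurd (isMaximal_of_three_le_height hdim p
            (three_le_height_of_lt hlt hm (hq.1.2 hI) hj₀ (hq.1.2 hjI))) hpm
        · exact hsub q hp 1 ((h2 q hp hpm).quotient_span_singleton (hf q (Or.inl hq)))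
      · exact (locGenLE_one_of_not_le hIp).of_surjective _ N.mkQ_surjective)
    (by
      intro p hp
      by_cases hp2 : LocGenLE I p 2
      · exact hp2.of_surjective _ N.mkQ_surjective
      · obtain ⟨q, hq, hqp⟩ := exists_minimalPrimes_le_of_not_locGenLE hp2
        obtain rfl := (hE2 q hq).eq_of_le hp.ne_top hqp
        exact hsub q hp 2 ((h3 q (hE2 q hq)).quotient_span_singleton (hf q (Or.inr hq))))
  obtain ⟨u, rfl⟩ := N.mkQ_surjective u
  obtain ⟨v, rfl⟩ := N.mkQ_surjective v
  have htop : N ⊔ Submodule.span D[X] {u, v} = ⊤ := by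
    have h9 : Submodule.comap N.mkQ (Submodule.map N.mkQ (Submodule.span D[X] {u, v})) = ⊤ := by
      rw [Submodule.map_span, Set.image_pair, huv, Submodule.comap_top]
    rwa [Submodule.comap_map_mkQ] at h9
  obtain ⟨φ, hφ⟩ := exists_map_eq_of_le_sup_mul (I := I)
    (J := Ideal.span (Set.range ![f.1, u.1, v.1])) (by
      rw [Ideal.span_le]
      rintro _ ⟨i, rfl⟩
      fin_cases i
      · exact f.2
      · exact u.2
      · exact v.2) hjI' (by
      intro x hx
      have hxt : (⟨x, hx⟩ : I) ∈ N ⊔ Submodule.span D[X] {u, v} := htop ▸ trivial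
      obtain ⟨y, hy, z, hz, hyz⟩ := Submodule.mem_sup.1 hxt
      obtain ⟨y₁, hy₁, y₂, ⟨w, rfl⟩, rfl⟩ := Submodule.mem_sup.1 hy
      obtain ⟨c₁, rfl⟩ := Submodule.mem_span_singleton.1 hy₁
      obtain ⟨c₂, c₃, rfl⟩ := Submodule.mem_span_pair.1 hz
      have hx' : x = (c₁ * f.1 + (c₂ * u.1 + c₃ * v.1)) + Polynomial.C j * w.1 := by
        have := congrArg Subtype.val hyz
        simp only [LinearMap.lsmul_apply, Submodule.coe_add, Submodule.coe_smul,
          smul_eq_mul] at this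
        rw [← this]; ring
      rw [hx']
      refine Submodule.add_mem_sup ?_
        (Ideal.mul_mem_mul (Ideal.mem_span_singleton_self _) w.2)
      exact add_mem (Ideal.mul_mem_left _ _ (Ideal.subset_span ⟨0, rfl⟩))
        (add_mem (Ideal.mul_mem_left _ _ (Ideal.subset_span ⟨1, rfl⟩))
          (Ideal.mul_mem_left _ _ (Ideal.subset_span ⟨2, rfl⟩))))
    hfm (Ideal.subset_span ⟨0, rfl⟩) (b := b) (Dvd.intro_left _ rfl)
  refine ⟨φ ∘ ![f.1, u.1, v.1], ?_⟩
  rw [Set.range_comp, ← Ideal.map_span, hφ]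

end ThreeGenerators

section Localization

lemma exists_forall_smul_mem {A M : Type*} [CommRing A] [AddCommGroup M] [Module A M]
    [Module.Finite A M] {p : Ideal A} [hp : p.IsPrime] {N : Submodule A M}
    (h : ∀ x : M, ∃ a ∉ p, a • x ∈ N) : ∃ a ∉ p, ∀ x : M, a • x ∈ N := by
  obtain ⟨n, m, hm⟩ := Module.Finite.exists_fin (R := A) (M := M)
  choose a ha ham using fun l => h (m l)
  refine ⟨∏ l, a l, ?_, fun x => ?_⟩
  · rw [hp.prod_mem_iff]
    rintro ⟨l, -, hl⟩
    exact ha l hl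
  · have hx : x ∈ Submodule.span A (Set.range m) := hm ▸ trivial
    induction hx using Submodule.span_induction with
    | mem x hx =>
      obtain ⟨l, rfl⟩ := hx
      rw [← Finset.prod_erase_mul _ _ (Finset.mem_univ l), mul_smul]
      exact Submodule.smul_mem _ _ (ham l)
    | zero => rw [smul_zero]; exact zero_mem _
    | add x y _ _ hx hy => rw [smul_add]; exact add_mem hx hy
    | smul c x _ hx => rw [smul_comm]; exact Submodule.smul_mem _ _ hx

lemma locGenLE_of_forall {A : Type*} [CommRing A] [IsNoetherianRing A] {I p : Ideal A} [p.IsPrime]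
    {n : ℕ} (x : Fin n → I)
    (h : ∀ z ∈ I, ∃ a ∉ p, a * z ∈ Ideal.span (Set.range fun i => (x i).1)) :
    LocGenLE I p n := by
  obtain ⟨a, ha, hax⟩ := exists_forall_smul_mem (p := p)
    (N := Submodule.span A (Set.range x)) (fun z : I => by
      obtain ⟨a, ha, haz⟩ := h z z.2
      refine ⟨a, ha, ?_⟩
      obtain ⟨c, hc⟩ := (Submodule.mem_span_range_iff_exists_fun A).1 haz
      refine (Submodule.mem_span_range_iff_exists_fun A).2 ⟨c, Subtype.ext ?_⟩
      simpa using hc)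
  exact ⟨a, ha, x, hax⟩

lemma locGenLE_of_map_eq_span {A : Type*} [CommRing A] [IsNoetherianRing A] {I p : Ideal A}
    [p.IsPrime] {n : ℕ} (y : Fin n → Localization.AtPrime p)
    (h : I.map (algebraMap A (Localization.AtPrime p)) = Ideal.span (Set.range y)) :
    LocGenLE I p n := by
  have hy : ∀ i, ∃ x : I, ∃ s : p.primeCompl,
      y i * algebraMap A (Localization.AtPrime p) s = algebraMap A (Localization.AtPrime p) x := by
    intro i
    have : y i ∈ I.map (algebraMap A (Localization.AtPrime p)) :=
      h ▸ Ideal.subset_span ⟨i, rfl⟩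
    obtain ⟨⟨x, s⟩, hxs⟩ := (IsLocalization.mem_map_algebraMap_iff p.primeCompl _).1 this
    exact ⟨x, s, hxs⟩
  choose x s hxs using hy
  refine locGenLE_of_forall x fun z hz => ?_
  set J := Ideal.span (Set.range fun i => (x i).1) with hJ
  have hle : Ideal.span (Set.range y) ≤ J.map (algebraMap A (Localization.AtPrime p)) := by
    rw [Ideal.span_le]
    rintro _ ⟨i, rfl⟩
    rw [SetLike.mem_coe, ← Ideal.mul_unit_mem_iff_mem _
      (IsLocalization.map_units (Localization.AtPrime p) (s i)), hxs]
    exact Ideal.mem_map_of_mem _ (Ideal.subset_span ⟨i, rfl⟩)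
  have hz' := hle (h ▸ Ideal.mem_map_of_mem _ hz)
  obtain ⟨m, hm, hmz⟩ := (IsLocalization.algebraMap_mem_map_algebraMap_iff p.primeCompl _ J z).1 hz'
  exact ⟨m, hm, hmz⟩

lemma exists_maximalIdeal_eq_span {A : Type*} [CommRing A] [IsRegularRing A]
    (p : Ideal A) [p.IsPrime] {n : ℕ} (hp : p.height = n) :
    ∃ y : Fin n → Localization.AtPrime p,
      IsLocalRing.maximalIdeal (Localization.AtPrime p) = Ideal.span (Set.range y) := by
  have hreg : IsRegularLocalRing (Localization.AtPrime p) :=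
    IsRegularRing.isRegularLocalRing_localization p
  have hrank :
      ((IsLocalRing.maximalIdeal (Localization.AtPrime p)).spanFinrank : WithBot ℕ∞) = n := by
    rw [IsRegularLocalRing.spanFinrank_maximalIdeal,
      IsLocalization.AtPrime.ringKrullDim_eq_height p,
      hp]
    rfl
  have hrank' : (IsLocalRing.maximalIdeal (Localization.AtPrime p)).spanFinrank = n := by
    exact_mod_cast hrank
  obtain ⟨s, hs, hspan⟩ := Submodule.FG.exists_span_finset_card_eq_spanFinrank
    (IsNoetherian.noetherian (IsLocalRing.maximalIdeal (Localization.AtPrime p)))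
  rw [hrank'] at hs
  refine ⟨fun i => (s.equivFinOfCardEq hs).symm i, ?_⟩
  rw [← hspan]
  congr 1
  ext x
  simp only [Finset.mem_coe, Set.mem_range]
  exact ⟨fun hx => ⟨s.equivFinOfCardEq hs ⟨x, hx⟩, by simp⟩, by rintro ⟨i, rfl⟩; exact (_ : s).2⟩

end Localization

section PrimeIntersection

variable {A : Type*} [CommRing A] {I : Ideal A} {r : ℕ} {P : Fin r → Ideal A}

lemma exists_mul_mem_of_irredundant (hIP : I = ⨅ j, P j)
    (hirr : ∀ j, ¬ (⨅ j' : {j' : Fin r // j' ≠ j}, P j') ≤ P j) (j : Fin r) :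
    ∃ c ∉ P j, ∀ x ∈ P j, c * x ∈ I := by
  obtain ⟨c, hc, hcj⟩ := Set.not_subset.1 (hirr j)
  refine ⟨c, hcj, fun x hx => ?_⟩
  rw [hIP, Ideal.mem_iInf]
  intro i
  by_cases hij : i = j
  · subst hij; exact Ideal.mul_mem_left _ _ hx
  · exact Ideal.mul_mem_right _ _ (Submodule.mem_iInf _ |>.1 hc ⟨i, hij⟩)

lemma exists_le_of_iInf_le (hIP : I = ⨅ j, P j) {p : Ideal A} (hp : p.IsPrime) (h : I ≤ p) :
    ∃ j, P j ≤ p := by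
  have h1 : (Finset.univ.inf P) ≤ p := by rwa [Finset.inf_univ_eq_iInf, ← hIP]
  obtain ⟨j, -, hj⟩ := (Ideal.IsPrime.inf_le' hp).1 h1
  exact ⟨j, hj⟩

lemma locGenLE_two_of_height_eq_two [IsRegularRing A] (hprime : ∀ j, (P j).IsPrime)
    (hht : ∀ j, (P j).height = 2) (hIP : I = ⨅ j, P j)
    (hirr : ∀ j, ¬ (⨅ j' : {j' : Fin r // j' ≠ j}, P j') ≤ P j) (j : Fin r) :
    LocGenLE I (P j) 2 := by
  have := hprime j
  obtain ⟨y, hy⟩ := exists_maximalIdeal_eq_span (P j) (n := 2) (hht j)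
  refine locGenLE_of_map_eq_span y ?_
  rw [← hy, ← IsLocalization.AtPrime.map_eq_maximalIdeal (P j)]
  refine le_antisymm (Ideal.map_mono (hIP ▸ iInf_le P j))
    (Ideal.map_le_iff_le_comap.2 fun x hx => ?_)
  obtain ⟨c, hc, hcx⟩ := exists_mul_mem_of_irredundant hIP hirr j
  exact (IsLocalization.algebraMap_mem_map_algebraMap_iff (P j).primeCompl _ I x).2
    ⟨c, hc, hcx x hx⟩

lemma eq_of_isPrime_of_not_isMaximal (hA : ringKrullDim A ≤ 3) (hprime : ∀ j, (P j).IsPrime)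
    (hht : ∀ j, (P j).height = 2) (hIP : I = ⨅ j, P j) {p : Ideal A} (hp : p.IsPrime)
    (hpm : ¬ p.IsMaximal) (h : I ≤ p) : ∃ j, P j = p := by
  obtain ⟨j, hj⟩ := exists_le_of_iInf_le hIP hp h
  refine ⟨j, hj.eq_of_not_lt fun hlt => hpm (isMaximal_of_three_le_height hA p ?_)⟩
  have := hprime j
  calc (3 : ℕ∞) = (P j).height + 1 := by rw [hht]; norm_num
    _ ≤ _ := height_add_one_le_of_lt hlt

lemma exists_span_three_of_mem_monic {D : Type*} [CommRing D] [IsDomain D] [IsRegularRing D]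
    [Infinite D] (hdim : ringKrullDim D[X] ≤ 3) {I : Ideal D[X]} {r : ℕ} {P : Fin r → Ideal D[X]}
    (hprime : ∀ j, (P j).IsPrime) (hht : ∀ j, (P j).height = 2) (hIP : I = ⨅ j, P j)
    (hirr : ∀ j, ¬ (⨅ j' : {j' : Fin r // j' ≠ j}, P j') ≤ P j)
    {h : D[X]} (hm : h.Monic) (hI : h ∈ I)
    (h3 : ∀ p : Ideal D[X], p.IsMaximal → LocGenLE I p 3) :
    ∃ f : Fin 3 → D[X], Ideal.span (Set.range f) = I := by
  have hd : ∀ j, ∃ d : D, d ≠ 0 ∧ Polynomial.C d ∈ P j := by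
    intro j
    have := hprime j
    by_contra! hcon
    have h1 : (P j).comap Polynomial.C = ⊥ := by
      rw [eq_bot_iff]
      intro d hd
      by_contra hd0
      exact hcon d hd0 hd
    have h2 := height_le_one_of_comap_C_eq_bot (P j) h1
    rw [hht] at h2
    exact absurd h2 (by decide)
  choose d hd0 hdP using hd
  refine exists_span_three_of_monic hdim hm hI (j₀ := ∏ j, d j)
    (Finset.prod_ne_zero_iff.2 fun j _ => hd0 j) ?_ (fun p hp hpm => ?_) h3
  · rw [hIP, Ideal.mem_iInf]
    intro j
    rw [map_prod]
    exact Ideal.mem_of_dvd _ (Finset.dvd_prod_of_mem _ (Finset.mem_univ j)) (hdP j)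
  · by_cases hIp : I ≤ p
    · obtain ⟨j, rfl⟩ := eq_of_isPrime_of_not_isMaximal hdim hprime hht hIP hp hpm hIp
      exact locGenLE_two_of_height_eq_two hprime hht hIP hirr j
    · exact (locGenLE_one_of_not_le hIp).mono one_le_two

lemma LocGenLE.map_ringEquiv {B : Type*} [CommRing B] (e : A ≃+* B) {p : Ideal B} {n : ℕ}
    (h : LocGenLE I (p.comap e) n) : LocGenLE (I.comap e.symm) p n := by
  obtain ⟨a, ha, m, hm⟩ := h
  refine ⟨e a, ha, fun i => ⟨e (m i), by simp⟩, fun x => ?_⟩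
  obtain ⟨c, hc⟩ := (Submodule.mem_span_range_iff_exists_fun A).1 (hm ⟨e.symm x.1, x.2⟩)
  refine (Submodule.mem_span_range_iff_exists_fun B).2 ⟨fun i => e (c i), Subtype.ext ?_⟩
  have := congrArg (fun y : I => e y.1) hc
  simpa using this

/-- A locally three-generated intersection of height two primes of `k[x, y, z]` is generated by
three elements. -/
lemma exists_span_three {k : Type*} [Field k] {I : Ideal (MvPolynomial (Fin 3) k)} {r : ℕ}
    {P : Fin r → Ideal (MvPolynomial (Fin 3) k)} (hprime : ∀ j, (P j).IsPrime)
    (hht : ∀ j, (P j).height = 2) (hIP : I = ⨅ j, P j)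
    (hirr : ∀ j, ¬ (⨅ j' : {j' : Fin r // j' ≠ j}, P j') ≤ P j)
    (h3 : ∀ p : Ideal (MvPolynomial (Fin 3) k), p.IsMaximal → LocGenLE I p 3) :
    ∃ f : Fin 3 → MvPolynomial (Fin 3) k, Ideal.span (Set.range f) = I := by
  have hI0 : ∃ x ∈ I, x ≠ 0 := by
    have : ∀ j, ∃ d ∈ P j, d ≠ 0 := fun j => by
      refine Submodule.exists_mem_ne_zero_of_ne_bot fun h => ?_
      have h1 := hht j
      rw [h, Ideal.height_bot] at h1
      exact absurd h1 (by decide)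
    choose d hd hd0 using this
    refine ⟨∏ j, d j, ?_, Finset.prod_ne_zero_iff.2 fun j _ => hd0 j⟩
    rw [hIP, Ideal.mem_iInf]
    exact fun j => Ideal.mem_of_dvd _ (Finset.dvd_prod_of_mem _ (Finset.mem_univ j)) (hd j)
  obtain ⟨x, hxI, hx0⟩ := hI0
  obtain ⟨e, he⟩ := exists_equiv_isUnit_leadingCoeff hx0
  have hmon : (e x * Polynomial.C he.unit⁻¹.1).Monic := by
    rw [Polynomial.Monic, Polynomial.leadingCoeff_mul, Polynomial.leadingCoeff_C]
    exact he.mul_val_inv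
  have hcomap : ∀ {ι : Sort _} (Q : ι → Ideal (MvPolynomial (Fin 3) k)),
      (⨅ i, Q i).comap e.symm = ⨅ i, (Q i).comap e.symm := fun Q => Ideal.comap_iInf _ _
  have hdim : ringKrullDim (Polynomial (MvPolynomial (Fin 2) k)) ≤ 3 := by
    rw [← ringKrullDim_eq_of_ringEquiv e, ringKrullDim_mvPolynomial]
    rfl
  have : IsRegularRing (MvPolynomial (Fin 2) k) := inferInstance
  obtain ⟨f, hf⟩ := exists_span_three_of_mem_monic (I := I.comap e.symm)
    (P := fun j => (P j).comap e.symm) hdim (fun j => by have := hprime j; infer_instance)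
    (fun j => by
      have := RingEquiv.height_comap e.symm (P j)
      rw [← hht j, ← this]) (by rw [hIP, hcomap])
    (fun j hle => hirr j (by
      rw [← hcomap] at hle
      intro y hy
      have := hle (show e y ∈ _ by simpa using hy)
      simpa using this))
    hmon (Ideal.mul_mem_right _ _ (by simpa using hxI))
    (fun p hp => LocGenLE.map_ringEquiv e (h3 _ (Ideal.comap_isMaximal_of_equiv e)))
  refine ⟨e.symm ∘ f, ?_⟩
  rw [Set.range_comp]
  have h4 := Ideal.map_span e.symm (Set.range f)
  have h5 : Ideal.map e.symm (I.comap e.symm) = I :=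
    Ideal.map_comap_of_surjective _ e.symm.surjective I
  rw [hf] at h4
  exact (h5.symm.trans h4).symm

end PrimeIntersection

section ReesKernel

variable {R : Type*} [CommRing R] {s : ℕ} {f : Fin s → R}

lemma aeval_C_mul_X_of_isHomogeneous (f : Fin s → R) {p : MvPolynomial (Fin s) R} {d : ℕ}
    (hp : p.IsHomogeneous d) :
    MvPolynomial.aeval (fun i => Polynomial.C (f i) * Polynomial.X) p =
      Polynomial.C (MvPolynomial.eval f p) * Polynomial.X ^ d := by
  rw [MvPolynomial.aeval_def, MvPolynomial.eval₂_eq', MvPolynomial.eval_eq', map_sum,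
    Finset.sum_mul]
  refine Finset.sum_congr rfl fun e he => ?_
  have hd : ∑ i, e i = d := by
    rw [← hp (MvPolynomial.mem_support_iff.1 he), Finsupp.weight_apply,
      Finsupp.sum_fintype _ _ (fun i => by simp)]
    simp
  simp only [mul_pow, Finset.prod_mul_distrib, Finset.prod_pow_eq_pow_sum, hd, map_mul, map_prod,
    map_pow, Polynomial.algebraMap_eq]
  ring

lemma mem_reesKer_iff_of_isHomogeneous {p : MvPolynomial (Fin s) R} {d : ℕ}
    (hp : p.IsHomogeneous d) : p ∈ reesKer f ↔ MvPolynomial.eval f p = 0 := by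
  rw [reesKer, RingHom.mem_ker]
  rw [aeval_C_mul_X_of_isHomogeneous f hp, ← Polynomial.monomial_zero_left,
    Polynomial.monomial_zero_left, Polynomial.C_mul_X_pow_eq_monomial,
    Polynomial.monomial_eq_zero_iff]

lemma homogeneousComponent_mem_reesKer {p : MvPolynomial (Fin s) R} (hp : p ∈ reesKer f) (d : ℕ) :
    MvPolynomial.homogeneousComponent d p ∈ reesKer f := by
  rw [mem_reesKer_iff_of_isHomogeneous (MvPolynomial.homogeneousComponent_isHomogeneous d p)]
  have h1 : MvPolynomial.aeval (fun i => Polynomial.C (f i) * Polynomial.X) p = 0 := hp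
  rw [← MvPolynomial.sum_homogeneousComponent p, map_sum] at h1
  simp only [aeval_C_mul_X_of_isHomogeneous f
    (MvPolynomial.homogeneousComponent_isHomogeneous _ _)] at h1
  have h2 := congrArg (fun q => Polynomial.coeff q d) h1
  simp only [Polynomial.finsetSum_coeff, Polynomial.coeff_C_mul_X_pow, Polynomial.coeff_zero] at h2
  by_cases hd : d ∈ Finset.range (p.totalDegree + 1)
  · rwa [Finset.sum_ite_eq _ d, if_pos hd] at h2
  · rw [MvPolynomial.homogeneousComponent_eq_zero _ _ (by simpa using hd), map_zero]

lemma genInDegLE_of_le {L : Ideal (MvPolynomial (Fin s) R)} {N : ℕ}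
    (h : L ≤ Ideal.span {p | p ∈ L ∧ ∃ q ≤ N, MvPolynomial.IsHomogeneous p q}) :
    GenInDegLE L N :=
  le_antisymm h (Ideal.span_le.2 fun _ hp => hp.1)

variable (f) in
lemma exists_genInDegLE_reesKer [IsNoetherianRing R] : ∃ N, 1 ≤ N ∧ GenInDegLE (reesKer f) N := by
  obtain ⟨S, hS⟩ := IsNoetherian.noetherian (reesKer f)
  refine ⟨S.sup MvPolynomial.totalDegree + 1, by omega, genInDegLE_of_le ?_⟩
  nth_rewrite 1 [← hS]
  refine Submodule.span_le.2 fun p hp => ?_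
  have hpL : p ∈ reesKer f := hS ▸ Submodule.subset_span hp
  rw [SetLike.mem_coe, ← MvPolynomial.sum_homogeneousComponent p]
  refine Ideal.sum_mem _ fun d hd => Ideal.subset_span
    ⟨homogeneousComponent_mem_reesKer hpL d, d, ?_,
      MvPolynomial.homogeneousComponent_isHomogeneous d p⟩
  have := Finset.le_sup (f := MvPolynomial.totalDegree) hp
  have := Finset.mem_range.1 hd
  omega

/-- The substitution by linear forms with coefficient matrix `d`. -/
noncomputable def linSubst {t : ℕ} (d : Fin s → Fin t → R) :
    MvPolynomial (Fin s) R →ₐ[R] MvPolynomial (Fin t) R :=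
  MvPolynomial.aeval fun i => ∑ j, MvPolynomial.C (d i j) * MvPolynomial.X j

lemma isHomogeneous_linForm {t : ℕ} (d : Fin t → R) :
    (∑ j, MvPolynomial.C (d j) * MvPolynomial.X j : MvPolynomial (Fin t) R).IsHomogeneous 1 :=
  MvPolynomial.IsHomogeneous.sum _ _ _ fun _ _ => MvPolynomial.isHomogeneous_C_mul_X _ _

lemma linSubst_isHomogeneous {t : ℕ} (d : Fin s → Fin t → R) {p : MvPolynomial (Fin s) R} {n : ℕ}
    (hp : p.IsHomogeneous n) : (linSubst d p).IsHomogeneous n := by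
  have := hp.aeval _ (fun i => isHomogeneous_linForm (d i))
  rwa [one_mul] at this

lemma linSubst_mem_reesKer {t : ℕ} {g : Fin t → R} {d : Fin s → Fin t → R}
    (hd : ∀ i, ∑ j, d i j * g j = f i) {p : MvPolynomial (Fin s) R} (hp : p ∈ reesKer f) :
    linSubst d p ∈ reesKer g := by
  have h1 : (MvPolynomial.aeval (fun i => Polynomial.C (g i) * Polynomial.X)).comp (linSubst d) =
      MvPolynomial.aeval (fun i => Polynomial.C (f i) * Polynomial.X) := by
    refine MvPolynomial.algHom_ext fun i => ?_
    simp only [linSubst, AlgHom.comp_apply, MvPolynomial.aeval_X, map_sum, map_mul, ← hd,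
      Finset.sum_mul, MvPolynomial.algHom_C, Polynomial.algebraMap_eq, mul_assoc]
  exact (AlgHom.congr_fun h1 p).trans hp

lemma sub_linSubst_linSubst_mem {t : ℕ} (c : Fin t → Fin s → R) (d : Fin s → Fin t → R)
    {K : Ideal (MvPolynomial (Fin t) R)}
    (hK : ∀ i, MvPolynomial.X i - linSubst d (linSubst c (MvPolynomial.X i)) ∈ K)
    (p : MvPolynomial (Fin t) R) : p - linSubst d (linSubst c p) ∈ K := by
  have h1 : Ideal.Quotient.mkₐ R K =
      (Ideal.Quotient.mkₐ R K).comp ((linSubst d).comp (linSubst c)) :=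
    MvPolynomial.algHom_ext fun i => Ideal.Quotient.mk_eq_mk_iff_sub_mem _ _ |>.2 (hK i)
  exact (Ideal.Quotient.mk_eq_mk_iff_sub_mem _ _).1 (AlgHom.congr_fun h1 p)

/-- The generating degrees of the equations of the Rees algebra do not depend on the choice of
generators. -/
lemma GenInDegLE.of_span_eq {t : ℕ} {g : Fin t → R} {N : ℕ} (hN : 1 ≤ N)
    (hfg : Ideal.span (Set.range f) = Ideal.span (Set.range g))
    (h : GenInDegLE (reesKer f) N) : GenInDegLE (reesKer g) N := by
  have hd : ∀ i, ∃ d : Fin t → R, ∑ j, d j * g j = f i := fun i =>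
    (Submodule.mem_span_range_iff_exists_fun R).1 (hfg.le (Ideal.subset_span ⟨i, rfl⟩))
  have hc : ∀ j, ∃ c : Fin s → R, ∑ i, c i * f i = g j := fun j =>
    (Submodule.mem_span_range_iff_exists_fun R).1 (hfg.ge (Ideal.subset_span ⟨j, rfl⟩))
  choose d hd using hd
  choose c hc using hc
  refine genInDegLE_of_le fun p hp => ?_
  set K := Ideal.span {p | p ∈ reesKer g ∧ ∃ q ≤ N, MvPolynomial.IsHomogeneous p q} with hK
  have h1 : linSubst d (linSubst c p) ∈ K := by
    have h2 : linSubst c p ∈ reesKer f := linSubst_mem_reesKer hc hp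
    rw [h] at h2
    have h3 := Ideal.mem_map_of_mem (linSubst d) h2
    rw [Ideal.map_span] at h3
    refine Ideal.span_mono ?_ h3
    rintro _ ⟨q, ⟨hq, n, hn, hqn⟩, rfl⟩
    exact ⟨linSubst_mem_reesKer hd hq, n, hn, linSubst_isHomogeneous d hqn⟩
  have h4 : p - linSubst d (linSubst c p) ∈ K := by
    refine sub_linSubst_linSubst_mem c d (fun i => ?_) p
    have h5 : (MvPolynomial.X i - linSubst d (linSubst c (MvPolynomial.X i))).IsHomogeneous 1 :=
      (MvPolynomial.isHomogeneous_X R i).sub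
        (linSubst_isHomogeneous d (linSubst_isHomogeneous c (MvPolynomial.isHomogeneous_X R i)))
    refine Ideal.subset_span ⟨?_, 1, hN, h5⟩
    rw [mem_reesKer_iff_of_isHomogeneous h5]
    have h6 : ∀ a, MvPolynomial.eval g (linSubst d (MvPolynomial.X a)) = f a := fun a => by
      simp [linSubst, hd]
    have h7 : MvPolynomial.eval g (linSubst d (linSubst c (MvPolynomial.X i))) = g i := by
      have : linSubst c (MvPolynomial.X i) = ∑ j, MvPolynomial.C (c i j) * MvPolynomial.X j := by
        simp [linSubst]
      rw [this, map_sum, map_sum, ← hc i]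
      refine Finset.sum_congr rfl fun a _ => ?_
      rw [map_mul, map_mul, h6, MvPolynomial.algHom_C]
      simp
    rw [map_sub, h7, MvPolynomial.eval_X, sub_self]
  simpa using add_mem h4 h1

lemma reesKer_le_span_linear_of_relType_le_two [IsNoetherianRing R] {I : Ideal R}
    (hI : Syzygetic I) (hrt : relType I ≤ 2) (hf : Ideal.span (Set.range f) = I) :
    reesKer f ≤ Ideal.span {q | q ∈ reesKer f ∧ q.IsHomogeneous 1} := by
  have hne : {N | 1 ≤ N ∧ ∀ (s : ℕ) (f : Fin s → R),
      Ideal.span (Set.range f) = I → GenInDegLE (reesKer f) N}.Nonempty := by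
    obtain ⟨N, hN, hfN⟩ := exists_genInDegLE_reesKer f
    exact ⟨N, hN, fun t g hg => hfN.of_span_eq hN (hf.trans hg.symm)⟩
  have hgen : reesKer f = _ := (Nat.sInf_mem hne).2 s f hf
  nth_rewrite 1 [hgen]
  rw [Ideal.span_le]
  rintro p ⟨hp, q, hq, hpq⟩
  have hq2 : q ≤ 2 := hq.trans hrt
  interval_cases q
  · have hC := MvPolynomial.totalDegree_eq_zero_iff_eq_C.1 (Nat.le_zero.1 hpq.totalDegree_le)
    have h0 := (mem_reesKer_iff_of_isHomogeneous hpq).1 hp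
    rw [hC, MvPolynomial.eval_C] at h0
    rw [hC, h0, map_zero]
    exact zero_mem _
  · exact Ideal.subset_span ⟨hp, hpq⟩
  · exact hI s f hf p hp hpq

end ReesKernel

section LinearType

lemma exists_eq_sum_C_mul_X {R : Type*} [CommRing R] {s : ℕ} {p : MvPolynomial (Fin s) R}
    (hp : p.IsHomogeneous 1) :
    ∃ a : Fin s → R, p = ∑ j, MvPolynomial.C (a j) * MvPolynomial.X j := by
  have h : p ∈ MvPolynomial.homogeneousSubmodule (Fin s) R 1 := hp
  rw [MvPolynomial.homogeneousSubmodule_one_eq_span_X,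
    Submodule.mem_span_range_iff_exists_fun] at h
  obtain ⟨a, rfl⟩ := h
  exact ⟨a, by simp only [MvPolynomial.smul_eq_C_mul]⟩

lemma trdeg_polynomial_mvPolynomial (k : Type*) [Field k] (n : ℕ) :
    Algebra.trdeg k (Polynomial (MvPolynomial (Fin n) k)) = n + 1 := by
  rw [← (MvPolynomial.finSuccEquiv k n).trdeg_eq, MvPolynomial.trdeg_of_isDomain]
  simp

variable {k : Type*} [Field k] {d : ℕ}

lemma exists_aevalTower_eq_zero {n : ℕ} (hn : d < n) {w : MvPolynomial (Fin d) k} (hw : w ≠ 0)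
    (u : Fin n → MvPolynomial (Fin d) k) :
    ∃ G : Polynomial (MvPolynomial (Fin n) k), G.coeff 0 ≠ 0 ∧
      Polynomial.aevalTower (MvPolynomial.aeval (R := k) fun i => Polynomial.C (u i) * Polynomial.X)
        (Polynomial.C w) G = 0 := by
  set ev := Polynomial.aevalTower (MvPolynomial.aeval (R := k)
    fun i => Polynomial.C (u i) * Polynomial.X) (Polynomial.C w) with hev
  let y : Option (Fin n) → Polynomial (MvPolynomial (Fin d) k) :=
    fun o => o.elim (Polynomial.C w) fun i => Polynomial.C (u i) * Polynomial.X
  have hy : ¬ AlgebraicIndependent k y := fun h => by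
    have h1 := h.lift_cardinalMk_le_trdeg
    rw [trdeg_polynomial_mvPolynomial] at h1
    simp only [Cardinal.mk_fintype, Fintype.card_option, Fintype.card_fin, Cardinal.lift_natCast,
      Cardinal.lift_add, Cardinal.lift_one] at h1
    have h2 : n + 1 ≤ d + 1 := by exact_mod_cast h1
    omega
  rw [algebraicIndependent_iff] at hy
  push Not at hy
  obtain ⟨G₀, hG₀, hne⟩ := hy
  have hcomp : ev.comp (MvPolynomial.optionEquivLeft k (Fin n)).toAlgHom =
      MvPolynomial.aeval y := by
    refine MvPolynomial.algHom_ext fun o => ?_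
    cases o with
    | none => simp [hev, y, MvPolynomial.optionEquivLeft_X_none]
    | some i => simp [hev, y, MvPolynomial.optionEquivLeft_X_some]
  have hG1 : ev (MvPolynomial.optionEquivLeft k (Fin n) G₀) = 0 :=
    (AlgHom.congr_fun hcomp G₀).trans hG₀
  obtain ⟨G, hG, hX⟩ := Polynomial.exists_eq_pow_rootMultiplicity_mul_and_not_dvd
    (MvPolynomial.optionEquivLeft k (Fin n) G₀) (by simpa using hne) 0
  rw [map_zero, sub_zero] at hG hX
  refine ⟨G, fun h0 => hX (Polynomial.X_dvd_iff.2 h0), ?_⟩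
  rw [hG, map_mul, map_pow, hev, Polynomial.aevalTower_X] at hG1
  exact (mul_eq_zero.1 hG1).resolve_left (pow_ne_zero _ (by simpa using hw))

lemma le_of_dual_family {I m : Ideal (MvPolynomial (Fin d) k)} [hm : m.IsMaximal] (hm0 : m ≠ ⊥)
    {s : ℕ} {f : Fin s → MvPolynomial (Fin d) k} (hf : Ideal.span (Set.range f) = I)
    (hL : reesKer f ≤ Ideal.span {q | q ∈ reesKer f ∧ q.IsHomogeneous 1}) {n : ℕ}
    (lam : Fin n → I →ₗ[MvPolynomial (Fin d) k] (MvPolynomial (Fin d) k ⧸ m)) (u : Fin n → I)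
    (hu : ∀ i j, lam i (u j) = if i = j then 1 else 0) : n ≤ d := by
  by_contra! hn
  obtain ⟨w, hwm, hw⟩ := Submodule.exists_mem_ne_zero_of_ne_bot hm0
  obtain ⟨G, hG0, hG⟩ := exists_aevalTower_eq_zero hn hw fun i => (u i).1
  have hfI : ∀ j, f j ∈ I := fun j => hf ▸ Ideal.subset_span ⟨j, rfl⟩
  have hsum : ∀ a : Fin s → MvPolynomial (Fin d) k, ∑ j, a j * f j ∈ I := fun a =>
    Ideal.sum_mem _ fun j _ => I.mul_mem_left _ (hfI j)
  let ψ : MvPolynomial (Fin s) (MvPolynomial (Fin d) k) →+*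
      MvPolynomial (Fin n) (MvPolynomial (Fin d) k ⧸ m) :=
    MvPolynomial.eval₂Hom (MvPolynomial.C.comp (Ideal.Quotient.mk m))
      fun j => ∑ i, MvPolynomial.C (lam i ⟨f j, hfI j⟩) * MvPolynomial.X i
  have hψlin : ∀ a : Fin s → MvPolynomial (Fin d) k,
      ψ (∑ j, MvPolynomial.C (a j) * MvPolynomial.X j) =
        ∑ i, MvPolynomial.C (lam i ⟨_, hsum a⟩) * MvPolynomial.X i := by
    intro a
    have h1 : (⟨_, hsum a⟩ : I) = ∑ j, a j • ⟨f j, hfI j⟩ := Subtype.ext (by simp)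
    simp only [h1, map_sum, map_smul, map_mul, Finset.sum_mul]
    rw [Finset.sum_comm]
    refine Finset.sum_congr rfl fun j _ => ?_
    simp only [ψ, MvPolynomial.coe_eval₂Hom, MvPolynomial.eval₂_C, MvPolynomial.eval₂_X,
      RingHom.comp_apply, Finset.mul_sum]
    refine Finset.sum_congr rfl fun i _ => ?_
    rw [← mul_assoc, ← map_mul]
    rfl
  have hψ : ∀ q ∈ reesKer f, ψ q = 0 := by
    suffices h : reesKer f ≤ RingHom.ker ψ from fun q hq => h hq
    refine hL.trans (Ideal.span_le.2 ?_)
    rintro q ⟨hq, hq1⟩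
    obtain ⟨a, rfl⟩ := exists_eq_sum_C_mul_X hq1
    rw [mem_reesKer_iff_of_isHomogeneous hq1] at hq
    rw [SetLike.mem_coe, RingHom.mem_ker, hψlin]
    have h0 : (⟨_, hsum a⟩ : I) = 0 := Subtype.ext (by simpa using hq)
    simp [h0]
  have hc : ∀ i, ∃ c : Fin s → MvPolynomial (Fin d) k, ∑ j, c j * f j = (u i).1 := fun i =>
    (Submodule.mem_span_range_iff_exists_fun _).1 (hf.ge (u i).2)
  choose c hc using hc
  let τ : Fin n → MvPolynomial (Fin s) (MvPolynomial (Fin d) k) := fun i =>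
    ∑ j, MvPolynomial.C (c i j) * MvPolynomial.X j
  have hψτ : ∀ i, ψ (τ i) = MvPolynomial.X i := by
    intro i
    have h1 : (⟨_, hsum (c i)⟩ : I) = u i := Subtype.ext (hc i)
    rw [hψlin, h1]
    simp [hu]
  let θ : Polynomial (MvPolynomial (Fin n) k) →ₐ[k] MvPolynomial (Fin s) (MvPolynomial (Fin d) k) :=
    Polynomial.aevalTower (MvPolynomial.aeval τ) (MvPolynomial.C w)
  have hθ : θ G ∈ reesKer f := by
    rw [reesKer, RingHom.mem_ker]
    rw [← hG]
    have h1 : ((MvPolynomial.aeval (fun i => Polynomial.C (f i) * Polynomial.X) :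
        MvPolynomial (Fin s) (MvPolynomial (Fin d) k) →ₐ[MvPolynomial (Fin d) k]
          Polynomial (MvPolynomial (Fin d) k)).restrictScalars k).comp θ =
        Polynomial.aevalTower (MvPolynomial.aeval (R := k)
          fun i => Polynomial.C (u i).1 * Polynomial.X) (Polynomial.C w) := by
      refine Polynomial.algHom_ext' ?_ ?_
      · refine MvPolynomial.algHom_ext fun i => ?_
        simp [θ, τ, ← hc, Finset.sum_mul, mul_assoc]
      · simp [θ]
    exact AlgHom.congr_fun h1 G
  have h2 : ψ (θ G) = MvPolynomial.map (algebraMap k (MvPolynomial (Fin d) k ⧸ m)) (G.coeff 0) := by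
    have h1 : ψ.comp (θ : Polynomial (MvPolynomial (Fin n) k) →+* _) =
        (MvPolynomial.map (algebraMap k (MvPolynomial (Fin d) k ⧸ m))).comp
          Polynomial.constantCoeff := by
      refine Polynomial.ringHom_ext' (MvPolynomial.ringHom_ext' ?_ fun i => ?_) ?_
      · ext a
        simp [θ, ψ]
        rfl
      · simp [θ, hψτ]
      · have : Ideal.Quotient.mk m w = 0 := Ideal.Quotient.eq_zero_iff_mem.2 hwm
        simp [θ, ψ, this]
    exact RingHom.congr_fun h1 G
  rw [hψ _ hθ] at h2
  exact hG0 (MvPolynomial.map_injective _ (algebraMap k _).injective (by rw [← h2, map_zero]))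


lemma locGenLE_of_reesKer_le {I m : Ideal (MvPolynomial (Fin d) k)} [hm : m.IsMaximal]
    (hm0 : m ≠ ⊥) {s : ℕ} {f : Fin s → MvPolynomial (Fin d) k} (hf : Ideal.span (Set.range f) = I)
    (hL : reesKer f ≤ Ideal.span {q | q ∈ reesKer f ∧ q.IsHomogeneous 1}) : LocGenLE I m d := by
  let _ := Ideal.Quotient.field m
  let b := Module.finBasis (MvPolynomial (Fin d) k ⧸ m)
    (I ⧸ (m • ⊤ : Submodule (MvPolynomial (Fin d) k) I))
  choose u hu using fun i => Submodule.mkQ_surjective _ (b i)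
  refine LocGenLE.mono (i := Module.finrank (MvPolynomial (Fin d) k ⧸ m)
    (I ⧸ (m • ⊤ : Submodule (MvPolynomial (Fin d) k) I))) ?_ ?_
  · set N := Submodule.span (MvPolynomial (Fin d) k) (Set.range u) with hN
    have h0 : LocGenLE (I ⧸ N) m 0 := by
      by_contra h
      obtain ⟨v, hv⟩ := exists_not_nonBasic h
      refine hv (NonBasic.of_mem hm.ne_top ?_)
      obtain ⟨v, rfl⟩ := Submodule.mkQ_surjective _ v
      choose a ha using fun i => Ideal.Quotient.mk_surjective (b.repr (Submodule.mkQ _ v) i)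
      have h1 : v - ∑ i, a i • u i ∈ (m • ⊤ : Submodule (MvPolynomial (Fin d) k) I) := by
        rw [← Submodule.Quotient.mk_eq_zero, ← Submodule.mkQ_apply, map_sub, sub_eq_zero, map_sum]
        nth_rewrite 1 [← b.sum_repr (Submodule.mkQ _ v)]
        refine Finset.sum_congr rfl fun i _ => ?_
        rw [map_smul, hu, ← ha]
        rfl
      have h2 : ∑ i, a i • u i ∈ N :=
        sum_mem fun i _ => N.smul_mem _ (Submodule.subset_span ⟨i, rfl⟩)
      have h3 := Submodule.mem_map_of_mem (f := N.mkQ) h1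
      rw [map_sub, Submodule.mkQ_apply N (∑ i, a i • u i), (Submodule.Quotient.mk_eq_zero N).2 h2,
        sub_zero, Submodule.map_smul''] at h3
      exact Submodule.smul_mono le_rfl le_top h3
    obtain ⟨a, ha, e, he⟩ := h0
    refine ⟨a, ha, u, fun x => ?_⟩
    have := he (Submodule.Quotient.mk x)
    rw [Set.range_eq_empty, Submodule.span_empty, Submodule.mem_bot,
      ← Submodule.Quotient.mk_smul, Submodule.Quotient.mk_eq_zero] at this
    exact this
  · refine le_of_dual_family hm0 hf hL
      (fun i => (b.coord i).restrictScalars (MvPolynomial (Fin d) k) ∘ₗ Submodule.mkQ _) u ?_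
    intro i j
    rw [LinearMap.comp_apply, hu]
    simp [Finsupp.single_apply, eq_comm]

end LinearType

section RegularSequence

open IsLocalRing

variable {S : Type*} [CommRing S]

/-- A regular sequence of length three, spelled out elementwise for a domain. -/
structure IsRegularTriple (t₁ t₂ t₃ : S) : Prop where
  ne_zero : t₁ ≠ 0
  dvd_of_dvd_mul : ∀ b, t₁ ∣ t₂ * b → t₁ ∣ b
  mem_of_mul_mem : ∀ z, t₃ * z ∈ Ideal.span {t₁, t₂} → z ∈ Ideal.span {t₁, t₂}

variable {t₁ t₂ t₃ : S}

lemma isRegularTriple_of_maximalIdeal_eq_span [IsLocalRing S] [IsNoetherianRing S]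
    [UniqueFactorizationMonoid S] (ht : maximalIdeal S = Ideal.span {t₁, t₂, t₃})
    (hh : 3 ≤ (maximalIdeal S).height) : IsRegularTriple t₁ t₂ t₃ := by
  have hpair : ∀ a b : S, maximalIdeal S ∉ (Ideal.span {a, b}).minimalPrimes := by
    intro a b h
    have h1 := Ideal.height_le_card_of_mem_minimalPrimes_span (Set.toFinite _) h
    have h2 : ({a, b} : Set S).ncard ≤ 2 := Set.ncard_insert_le a {b} |>.trans (by simp)
    have h3 : (3 : ℕ∞) ≤ (2 : ℕ) := hh.trans (h1.trans (by exact_mod_cast h2))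
    exact absurd h3 (by decide)
  have hmem : ∀ x ∈ ({t₁, t₂, t₃} : Set S), x ∈ maximalIdeal S := fun x hx =>
    ht ▸ Ideal.subset_span hx
  have h1 : t₁ ∈ maximalIdeal S := hmem _ (by simp)
  have h2 : t₂ ∈ maximalIdeal S := hmem _ (by simp)
  have h3 : t₃ ∈ maximalIdeal S := hmem _ (by simp)
  have hrel : IsRelPrime t₁ t₂ := by
    intro c hc1 hc2
    by_contra hc
    refine hpair c t₃ ?_
    have : maximalIdeal S = Ideal.span {c, t₃} := by
      refine le_antisymm ?_ ?_
      · rw [ht, Ideal.span_le]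
        rintro x (rfl | rfl | rfl)
        · exact Ideal.mem_of_dvd _ hc1 (Ideal.subset_span (by simp))
        · exact Ideal.mem_of_dvd _ hc2 (Ideal.subset_span (by simp))
        · exact Ideal.subset_span (by simp)
      · rw [Ideal.span_le]
        rintro x (rfl | rfl)
        · exact (mem_maximalIdeal _).2 hc
        · exact h3
    rw [← this, Ideal.minimalPrimes_eq_subsingleton_self]
    rfl
  refine ⟨?_, fun b => hrel.dvd_of_dvd_mul_left, fun z hz => ?_⟩
  · rintro rfl
    refine hpair t₂ t₃ ?_
    have : maximalIdeal S = Ideal.span {t₂, t₃} := by rw [ht, Ideal.span_insert_zero]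
    rw [← this, Ideal.minimalPrimes_eq_subsingleton_self]
    rfl
  · by_contra hzJ
    set J := Ideal.span {t₁, t₂} with hJ
    have hJm : J ≤ maximalIdeal S := by
      rw [hJ, Ideal.span_le]
      rintro x (rfl | rfl) <;> assumption
    have hmJ : maximalIdeal S = J ⊔ Ideal.span {t₃} := by
      rw [ht, hJ, ← Ideal.span_union]
      congr 1
      ext x
      simp only [Set.mem_insert_iff, Set.mem_singleton_iff, Set.mem_union, or_assoc]
    have hpow : ∀ n, t₃ ^ n ∉ J := by
      intro n hn
      refine hpair t₁ t₂ ⟨⟨inferInstance, hJm⟩, fun q ⟨hq, hJq⟩ _ => ?_⟩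
      rw [hmJ]
      exact sup_le hJq (by simpa using hq.mem_of_pow_mem n (hJq hn))
    have hex : ∃ n, z ∉ J ⊔ Ideal.span {t₃ ^ n} := by
      by_contra! hall
      refine hzJ ((Submodule.Quotient.mk_eq_zero J).1 ((Submodule.mem_bot S).1 ?_))
      rw [← Ideal.iInf_pow_smul_eq_bot_of_isLocalRing (M := S ⧸ J) (Ideal.span {t₃})
        (ne_top_of_le_ne_top (maximalIdeal.isMaximal S).ne_top (by simpa using h3)),
        Submodule.mem_iInf]
      intro n
      obtain ⟨j, hj, c, hc, hz⟩ := Submodule.mem_sup.1 (hall n)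
      obtain ⟨c, rfl⟩ := Ideal.mem_span_singleton'.1 hc
      rw [← hz, Submodule.Quotient.mk_add, (Submodule.Quotient.mk_eq_zero J).2 hj, zero_add,
        mul_comm, ← smul_eq_mul, Submodule.Quotient.mk_smul]
      exact Submodule.smul_mem_smul (Ideal.pow_mem_pow (Ideal.mem_span_singleton_self _) n)
        Submodule.mem_top
    classical
    obtain ⟨n, hn⟩ : ∃ n, Nat.find hex = n + 1 := Nat.exists_eq_succ_of_ne_zero fun h0 => by
      have := Nat.find_spec hex
      rw [h0] at this
      simp at this
    have hzn : z ∈ J ⊔ Ideal.span {t₃ ^ n} := not_not.1 (Nat.find_min hex (by omega))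
    have hzn' : z ∉ J ⊔ Ideal.span {t₃ ^ (n + 1)} := hn ▸ Nat.find_spec hex
    obtain ⟨j, hj, c, hc, rfl⟩ := Submodule.mem_sup.1 hzn
    obtain ⟨c, rfl⟩ := Ideal.mem_span_singleton'.1 hc
    by_cases hcu : IsUnit c
    · have h4 : c * t₃ ^ (n + 1) ∈ J := by
        have := J.sub_mem hz (J.mul_mem_left t₃ hj)
        convert this using 1
        ring
      exact hpow (n + 1) ((Ideal.unit_mul_mem_iff_mem J hcu).1 h4)
    · have hcm : c ∈ J ⊔ Ideal.span {t₃} := hmJ ▸ (mem_maximalIdeal c).2 hcu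
      obtain ⟨j', hj', e, he, rfl⟩ := Submodule.mem_sup.1 hcm
      obtain ⟨e, rfl⟩ := Ideal.mem_span_singleton'.1 he
      refine hzn' (Submodule.mem_sup.2 ⟨j + j' * t₃ ^ n, J.add_mem hj (J.mul_mem_right _ hj'),
        e * t₃ ^ (n + 1), Ideal.mem_span_singleton'.2 ⟨e, rfl⟩, by ring⟩)

variable [IsDomain S]

lemma IsRegularTriple.koszul_two (h : IsRegularTriple t₁ t₂ t₃) {z₁₂ z₁₃ z₂₃ : S}
    (hz : t₁ * z₂₃ - t₂ * z₁₃ + t₃ * z₁₂ = 0) :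
    ∃ x₁ x₂ x₃, z₁₂ = t₁ * x₂ - t₂ * x₁ ∧ z₁₃ = t₁ * x₃ - t₃ * x₁ ∧ z₂₃ = t₂ * x₃ - t₃ * x₂ := by
  obtain ⟨x₂, x₁, hx⟩ := Ideal.mem_span_pair.1 (h.mem_of_mul_mem z₁₂
    (Ideal.mem_span_pair.2 ⟨-z₂₃, z₁₃, by linear_combination -hz⟩))
  obtain ⟨x₃, hx₃⟩ := h.dvd_of_dvd_mul (z₁₃ - t₃ * x₁) ⟨z₂₃ + t₃ * x₂, by
    linear_combination -hz - t₃ * hx⟩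
  refine ⟨-x₁, x₂, x₃, by linear_combination -hx, by linear_combination hx₃, ?_⟩
  refine mul_left_cancel₀ h.ne_zero ?_
  linear_combination hz + t₃ * hx + t₂ * hx₃

lemma IsRegularTriple.koszul_one (h : IsRegularTriple t₁ t₂ t₃) {y₁ y₂ y₃ : S}
    (h₁₂ : t₁ * y₂ = t₂ * y₁) (h₁₃ : t₁ * y₃ = t₃ * y₁) :
    ∃ y, y₁ = t₁ * y ∧ y₂ = t₂ * y ∧ y₃ = t₃ * y := by
  obtain ⟨y, hy⟩ := h.dvd_of_dvd_mul y₁ ⟨y₂, h₁₂.symm⟩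
  refine ⟨y, hy, mul_left_cancel₀ h.ne_zero ?_, mul_left_cancel₀ h.ne_zero ?_⟩
  · linear_combination h₁₂ + t₂ * hy
  · linear_combination h₁₃ + t₃ * hy

end RegularSequence

section Syzygies

open IsLocalRing TensorProduct

variable {S : Type*} [CommRing S] {t₁ t₂ t₃ : S} {ι : Type*} [Fintype ι]

/-- The syzygies of the family `f`. -/
abbrev syz (f : ι → S) : Submodule S (ι → S) := LinearMap.ker (Fintype.linearCombination S f)

lemma mem_syz {f v : ι → S} : v ∈ syz f ↔ ∑ i, v i * f i = 0 := by
  simp [syz, Fintype.linearCombination_apply]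

variable [IsDomain S]

lemma mem_syz_of_smul_mem {f v : ι → S} {t : S} (ht : t ≠ 0) (h : t • v ∈ syz f) : v ∈ syz f := by
  rw [LinearMap.mem_ker, map_smul] at h
  exact (smul_eq_zero.1 h).resolve_left ht

lemma IsRegularTriple.tmul_syz_eq_zero (h : IsRegularTriple t₁ t₂ t₃) (f : ι → S)
    (hcolon : ∀ e, t₁ * e ∈ Ideal.span (Set.range f) → t₂ * e ∈ Ideal.span (Set.range f) →
      t₃ * e ∈ Ideal.span (Set.range f) → e ∈ Ideal.span (Set.range f))
    {M : Ideal S} (h₁ : t₁ ∈ M) (h₂ : t₂ ∈ M) (h₃ : t₃ ∈ M) (v₁ v₂ v₃ : syz f)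
    (hv : t₁ • v₁ + t₂ • v₂ + t₃ • v₃ = 0) :
    (⟨t₁, h₁⟩ : M) ⊗ₜ[S] v₁ + (⟨t₂, h₂⟩ : M) ⊗ₜ[S] v₂ + (⟨t₃, h₃⟩ : M) ⊗ₜ[S] v₃ = 0 := by
  have hv' : ∀ i, t₁ * v₁.1 i - t₂ * -v₂.1 i + t₃ * v₃.1 i = 0 := fun i => by
    have := congrFun (congrArg Subtype.val hv) i
    simp only [Submodule.coe_add, Submodule.coe_smul, Pi.add_apply, Pi.smul_apply, smul_eq_mul,
      ZeroMemClass.coe_zero, Pi.zero_apply] at this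
    linear_combination this
  choose x₁ x₂ x₃ h12 h13 h23 using fun i => h.koszul_two (hv' i)
  have e1 := mem_syz.1 v₁.2
  have e2 := mem_syz.1 v₂.2
  have e3 := mem_syz.1 v₃.2
  have e12 : t₁ * ∑ i, x₂ i * f i = t₂ * ∑ i, x₁ i * f i := by
    rw [← sub_eq_zero, ← e3, Finset.mul_sum, Finset.mul_sum, ← Finset.sum_sub_distrib]
    exact Finset.sum_congr rfl fun i _ => by rw [h12]; ring
  have e13 : t₁ * ∑ i, x₃ i * f i = t₃ * ∑ i, x₁ i * f i := by
    rw [← sub_eq_zero, ← neg_eq_zero, ← e2, Finset.mul_sum, Finset.mul_sum,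
      ← Finset.sum_sub_distrib, ← Finset.sum_neg_distrib]
    exact Finset.sum_congr rfl fun i _ => by linear_combination f i * h13 i
  obtain ⟨e, he₁, he₂, he₃⟩ := h.koszul_one e12 e13
  have hmem : ∀ x : ι → S, ∑ i, x i * f i ∈ Ideal.span (Set.range f) := fun x =>
    Ideal.sum_mem _ fun i _ => Ideal.mul_mem_left _ _ (Ideal.subset_span ⟨i, rfl⟩)
  obtain ⟨g, hg⟩ := (Submodule.mem_span_range_iff_exists_fun S).1
    (hcolon e (he₁ ▸ hmem _) (he₂ ▸ hmem _) (he₃ ▸ hmem _))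
  have hsub : ∀ (x : ι → S) (t : S), ∑ i, x i * f i = t * e → x - t • g ∈ syz f := by
    intro x t hx
    rw [mem_syz]
    simp only [Pi.sub_apply, Pi.smul_apply, smul_eq_mul, sub_mul, Finset.sum_sub_distrib, hx, ← hg,
      Finset.mul_sum, mul_assoc, sub_self]
  let y₁ : syz f := ⟨_, hsub x₁ t₁ he₁⟩
  let y₂ : syz f := ⟨_, hsub x₂ t₂ he₂⟩
  let y₃ : syz f := ⟨_, hsub x₃ t₃ he₃⟩
  have hv1 : v₁ = t₂ • y₃ - t₃ • y₂ := Subtype.ext (funext fun i => by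
    simp only [y₂, y₃, Submodule.coe_sub, Submodule.coe_smul, Pi.sub_apply, Pi.smul_apply,
      smul_eq_mul, h23]
    ring)
  have hv2 : v₂ = t₃ • y₁ - t₁ • y₃ := Subtype.ext (funext fun i => by
    simp only [y₁, y₃, Submodule.coe_sub, Submodule.coe_smul, Pi.sub_apply, Pi.smul_apply,
      smul_eq_mul]
    linear_combination -h13 i)
  have hv3 : v₃ = t₁ • y₂ - t₂ • y₁ := Subtype.ext (funext fun i => by
    simp only [y₁, y₂, Submodule.coe_sub, Submodule.coe_smul, Pi.sub_apply, Pi.smul_apply,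
      smul_eq_mul, h12]
    ring)
  have hcomm : ∀ (a b : S) (ha : a ∈ M) (hb : b ∈ M) (y : syz f),
      (⟨a, ha⟩ : M) ⊗ₜ[S] (b • y) = (⟨b, hb⟩ : M) ⊗ₜ[S] (a • y) := fun a b ha hb y => by
    rw [← TensorProduct.smul_tmul, ← TensorProduct.smul_tmul]
    congr 1
    exact Subtype.ext (mul_comm _ _)
  rw [hv1, hv2, hv3]
  simp only [TensorProduct.tmul_sub]
  rw [hcomm t₂ t₁ h₂ h₁, hcomm t₃ t₁ h₃ h₁, hcomm t₃ t₂ h₃ h₂]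
  abel

lemma IsRegularTriple.free_syz [IsLocalRing S] [IsNoetherianRing S]
    (h : IsRegularTriple t₁ t₂ t₃) (ht : maximalIdeal S = Ideal.span {t₁, t₂, t₃}) (f : ι → S)
    (hcolon : ∀ e, t₁ * e ∈ Ideal.span (Set.range f) → t₂ * e ∈ Ideal.span (Set.range f) →
      t₃ * e ∈ Ideal.span (Set.range f) → e ∈ Ideal.span (Set.range f)) :
    Module.Free S (syz f) := by
  have := Module.finitePresentation_of_finite S (syz f)
  have hmem : ∀ x ∈ ({t₁, t₂, t₃} : Set S), x ∈ maximalIdeal S := fun x hx =>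
    ht ▸ Ideal.subset_span hx
  have h₁ : t₁ ∈ maximalIdeal S := hmem _ (by simp)
  have h₂ : t₂ ∈ maximalIdeal S := hmem _ (by simp)
  have h₃ : t₃ ∈ maximalIdeal S := hmem _ (by simp)
  refine Module.free_of_maximalIdeal_rTensor_injective ?_
  rw [← LinearMap.ker_eq_bot, LinearMap.ker_eq_bot']
  have hrep : ∀ x : maximalIdeal S ⊗[S] syz f, ∃ v₁ v₂ v₃ : syz f,
      x = (⟨t₁, h₁⟩ : maximalIdeal S) ⊗ₜ[S] v₁ + (⟨t₂, h₂⟩ : maximalIdeal S) ⊗ₜ[S] v₂ +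
        (⟨t₃, h₃⟩ : maximalIdeal S) ⊗ₜ[S] v₃ := by
    intro x
    induction x with
    | zero => exact ⟨0, 0, 0, by simp⟩
    | add x y hx hy =>
      obtain ⟨v₁, v₂, v₃, rfl⟩ := hx
      obtain ⟨w₁, w₂, w₃, rfl⟩ := hy
      refine ⟨v₁ + w₁, v₂ + w₂, v₃ + w₃, ?_⟩
      simp only [TensorProduct.tmul_add]
      abel
    | tmul x v =>
      obtain ⟨a, y, hy, hx⟩ := Ideal.mem_span_insert.1 (ht.le x.2)
      obtain ⟨b, c, rfl⟩ := Ideal.mem_span_pair.1 hy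
      refine ⟨a • v, b • v, c • v, ?_⟩
      simp only [← TensorProduct.smul_tmul, ← TensorProduct.add_tmul]
      congr 1
      exact Subtype.ext (by simp [hx, add_assoc])
  intro x hx
  obtain ⟨v₁, v₂, v₃, rfl⟩ := hrep x
  refine h.tmul_syz_eq_zero f hcolon h₁ h₂ h₃ v₁ v₂ v₃ ?_
  have := congrArg (TensorProduct.lid S (syz f)) hx
  simpa using this

end Syzygies

section AlternatingForms

open Matrix

variable {S : Type*} [CommRing S] {ι : Type*}

/-- Square matrices of alternating bilinear forms. -/
def IsAltMatrix (D : Matrix ι ι S) : Prop :=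
  (∀ i, D i i = 0) ∧ ∀ i j, D i j + D j i = 0

lemma IsAltMatrix.add {D E : Matrix ι ι S} (hD : IsAltMatrix D) (hE : IsAltMatrix E) :
    IsAltMatrix (D + E) :=
  ⟨fun i => by simp [hD.1 i, hE.1 i], fun i j => by
    simp only [Matrix.add_apply]; linear_combination hD.2 i j + hE.2 i j⟩

lemma IsAltMatrix.smul {D : Matrix ι ι S} (hD : IsAltMatrix D) (t : S) : IsAltMatrix (t • D) :=
  ⟨fun i => by simp [hD.1 i], fun i j => by
    simp only [Matrix.smul_apply, smul_eq_mul]; linear_combination t * hD.2 i j⟩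

lemma IsAltMatrix.sub {D E : Matrix ι ι S} (hD : IsAltMatrix D) (hE : IsAltMatrix E) :
    IsAltMatrix (D - E) :=
  ⟨fun i => by simp [hD.1 i, hE.1 i], fun i j => by
    simp only [Matrix.sub_apply]; linear_combination hD.2 i j - hE.2 i j⟩

lemma IsAltMatrix.of_smul [IsDomain S] {D : Matrix ι ι S} {t : S} (ht : t ≠ 0)
    (hD : IsAltMatrix (t • D)) : IsAltMatrix D := by
  refine ⟨fun i => (mul_eq_zero.1 (hD.1 i)).resolve_left ht, fun i j => ?_⟩
  have := hD.2 i j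
  simp only [Matrix.smul_apply, smul_eq_mul, ← mul_add] at this
  exact (mul_eq_zero.1 this).resolve_left ht

lemma IsAltMatrix.sum_eq_zero [Fintype ι] {D : Matrix ι ι S} (hD : IsAltMatrix D) (v : ι → S) :
    ∑ i, ∑ j, v i * D i j * v j = 0 := by
  rw [← Finset.sum_product']
  refine Finset.sum_involution (fun p _ => p.swap) (fun p _ => ?_) (fun p _ hp heq => hp ?_)
    (fun _ _ => Finset.mem_univ _) (fun _ _ => Prod.swap_swap _)
  · simp only [Prod.fst_swap, Prod.snd_swap]
    linear_combination v p.1 * v p.2 * hD.2 p.1 p.2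
  · have : p.2 = p.1 := congrArg Prod.fst heq
    rw [this, hD.1, mul_zero, zero_mul]

lemma IsAltMatrix.congr [Fintype ι] {κ : Type*} {D : Matrix ι ι S} (hD : IsAltMatrix D)
    (φ : κ → ι → S) : IsAltMatrix (Matrix.of fun a b => ∑ i, ∑ j, φ a i * D i j * φ b j) := by
  refine ⟨fun a => hD.sum_eq_zero _, fun a b => ?_⟩
  simp only [of_apply]
  rw [Finset.sum_comm (f := fun i j => φ b i * D i j * φ a j), ← Finset.sum_add_distrib]
  refine Finset.sum_eq_zero fun i _ => ?_
  rw [← Finset.sum_add_distrib]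
  refine Finset.sum_eq_zero fun j _ => ?_
  linear_combination φ a i * φ b j * hD.2 i j

lemma IsRegularTriple.koszul_two_alt [IsDomain S] {t₁ t₂ t₃ : S} (h : IsRegularTriple t₁ t₂ t₃)
    [LinearOrder ι] {z₁₂ z₁₃ z₂₃ : Matrix ι ι S} (h12 : IsAltMatrix z₁₂) (h13 : IsAltMatrix z₁₃)
    (h23 : IsAltMatrix z₂₃) (hz : t₁ • z₂₃ - t₂ • z₁₃ + t₃ • z₁₂ = 0) :
    ∃ x₁ x₂ x₃ : Matrix ι ι S, IsAltMatrix x₁ ∧ IsAltMatrix x₂ ∧ IsAltMatrix x₃ ∧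
      z₁₂ = t₁ • x₂ - t₂ • x₁ ∧ z₁₃ = t₁ • x₃ - t₃ • x₁ ∧ z₂₃ = t₂ • x₃ - t₃ • x₂ := by
  choose x₁ x₂ x₃ e12 e13 e23 using fun i j => h.koszul_two (congrFun (congrFun hz i) j)
  let alt : (Matrix ι ι S) → Matrix ι ι S :=
    fun x => Matrix.of fun i j => if i < j then x i j else if j < i then -x j i else 0
  have halt : ∀ x, IsAltMatrix (alt x) := fun x =>
    ⟨fun i => by simp [alt], fun i j => by
      rcases lt_trichotomy i j with hij | rfl | hij
      · simp [alt, hij, hij.not_gt]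
      · simp [alt]
      · simp [alt, hij, hij.not_gt]⟩
  have key : ∀ {z x y : Matrix ι ι S} {s t : S}, IsAltMatrix z →
      (∀ i j, z i j = s * x i j - t * y i j) → z = s • alt x - t • alt y := by
    intro z x y s t hz hxy
    funext i j
    rcases lt_trichotomy i j with hij | rfl | hij
    · simp [alt, hij, hxy]
    · simp [alt, hz.1]
    · simp only [alt, of_apply, hij, hij.not_gt, Matrix.sub_apply, Matrix.smul_apply, smul_eq_mul,
        if_true, if_false]
      linear_combination hz.2 i j - hxy j i
  exact ⟨alt x₁, alt x₂, alt x₃, halt _, halt _, halt _, key h12 e12, key h13 e13, key h23 e23⟩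

variable [Fintype ι] [IsDomain S]

lemma exists_mul_transpose_eq_one {κ : Type*} [Fintype κ] [DecidableEq κ] {B : Matrix κ ι S}
    (hB : LinearIndependent S B.row) :
    ∃ Ψ : Matrix κ ι (FractionRing S), Ψ * (B.map (algebraMap S (FractionRing S)))ᵀ = 1 := by
  classical
  let K := FractionRing S
  let φK : κ → ι → K := fun a i => algebraMap S K (B a i)
  have h1 : LinearIndependent S φK :=
    hB.map_injOn (LinearMap.compLeft (Algebra.linearMap S K) ι) (Function.Injective.injOn
      fun v w hvw => funext fun i => IsFractionRing.injective S K (congrFun hvw i))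
  have h2 : LinearIndependent K φK := (LinearIndependent.iff_fractionRing S K).1 h1
  obtain ⟨g, hg⟩ := LinearMap.exists_leftInverse_of_injective (Fintype.linearCombination K φK)
    (LinearMap.ker_eq_bot.2 (linearIndependent_iff_injective_fintypeLinearCombination.1 h2))
  refine ⟨LinearMap.toMatrix' g, ?_⟩
  rw [← LinearMap.toMatrix'_id (R := K) (n := κ), ← hg, LinearMap.toMatrix'_comp]
  congr 1
  ext i a
  simp [φK, K, LinearMap.toMatrix'_apply, Fintype.linearCombination_apply, Pi.single_apply,
    ite_apply]

lemma IsAltMatrix.mul_mul_transpose {R κ : Type*} [CommRing R] {D : Matrix ι ι R}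
    (hD : IsAltMatrix D) (B : Matrix κ ι R) : IsAltMatrix (B * D * Bᵀ) := by
  convert hD.congr B using 1
  ext a b
  simp only [of_apply, mul_apply, transpose_apply, Finset.sum_mul]
  exact Finset.sum_comm

omit [Fintype ι] [IsDomain S] in
lemma isAltMatrix_map_iff {R : Type*} [CommRing R] {g : S →+* R} (hg : Function.Injective g)
    {D : Matrix ι ι S} : IsAltMatrix (D.map g) ↔ IsAltMatrix D := by
  simp only [IsAltMatrix, map_apply, ← map_add, map_eq_zero_iff g hg]

omit [Fintype ι] [IsDomain S] in
lemma eq_zero_of_mul_eq_zero {κ ν : Type*} [Fintype κ] {B : Matrix κ ι S}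
    (hB : LinearIndependent S B.row) {X : Matrix ν κ S} (h : X * B = 0) : X = 0 := by
  ext i a
  refine congrFun (vecMul_injective_iff.2 hB (?_ : X i ᵥ* B = 0 ᵥ* B)) a
  rw [zero_vecMul]
  exact congrFun h i

lemma IsAltMatrix.exists_eq_transpose_mul_mul {f : ι → S} {κ : Type*} [Fintype κ] [DecidableEq κ]
    {B : Matrix κ ι S} (hB : LinearIndependent S B.row)
    (hspan : ∀ v ∈ syz f, ∃ c, c ᵥ* B = v) {D : Matrix ι ι S} (hD : IsAltMatrix D)
    (hDf : ∀ i, D i ∈ syz f) : ∃ C : Matrix κ κ S, IsAltMatrix C ∧ D = Bᵀ * C * B := by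
  obtain ⟨Ψ, hΨ⟩ := exists_mul_transpose_eq_one hB
  choose c hc using fun i => hspan _ (hDf i)
  have hinj := IsFractionRing.injective S (FractionRing S)
  have hcB : D = Matrix.of c * B := by
    ext i j; rw [← hc i]; rfl
  have hDt : Dᵀ = -D := by
    ext i j; rw [transpose_apply, neg_apply]; linear_combination hD.2 j i
  have hD0 : D *ᵥ f = 0 := funext fun i => mem_syz.1 (hDf i)
  have h0 : Bᵀ *ᵥ ((Matrix.of c)ᵀ *ᵥ f) = 0 := by
    rw [mulVec_mulVec, ← transpose_mul, ← hcB, hDt, neg_mulVec, hD0, neg_zero]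
  have h1 : (Matrix.of c)ᵀ *ᵥ f = 0 := by
    refine vecMul_injective_iff.2 hB ?_
    rw [mulVec_transpose] at h0
    exact h0.trans (zero_vecMul _).symm
  choose C hC using fun a => hspan ((Matrix.of c)ᵀ a) (mem_syz.2 (congrFun h1 a))
  have hcC : (Matrix.of c)ᵀ = Matrix.of C * B := by
    ext a i; rw [← hC a]; rfl
  have hDC : D = Bᵀ * (Matrix.of C)ᵀ * B := by
    rw [← transpose_mul, ← hcC, transpose_transpose, ← hcB]
  refine ⟨(Matrix.of C)ᵀ, ?_, hDC⟩
  rw [← isAltMatrix_map_iff hinj] at hD ⊢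
  convert hD.mul_mul_transpose Ψ using 1
  have hBt : Bᵀ.map (algebraMap S (FractionRing S)) = (B.map (algebraMap S (FractionRing S)))ᵀ :=
    rfl
  rw [hDC, Matrix.map_mul, Matrix.map_mul, hBt, ← Matrix.mul_assoc, ← Matrix.mul_assoc,
    hΨ, Matrix.one_mul, Matrix.mul_assoc]
  rw [← transpose_transpose (B.map _), ← transpose_mul, hΨ, transpose_one, Matrix.mul_one]

lemma IsRegularTriple.koszul_two_alt_syz [IsNoetherianRing S] {t₁ t₂ t₃ : S}
    (h : IsRegularTriple t₁ t₂ t₃) {f : ι → S} [Module.Free S (syz f)] {z₁₂ z₁₃ z₂₃ : Matrix ι ι S}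
    (h12 : IsAltMatrix z₁₂) (h13 : IsAltMatrix z₁₃) (h23 : IsAltMatrix z₂₃)
    (h12f : ∀ i, z₁₂ i ∈ syz f) (h13f : ∀ i, z₁₃ i ∈ syz f) (h23f : ∀ i, z₂₃ i ∈ syz f)
    (hz : t₁ • z₂₃ - t₂ • z₁₃ + t₃ • z₁₂ = 0) :
    ∃ x₁ x₂ x₃ : Matrix ι ι S, IsAltMatrix x₁ ∧ IsAltMatrix x₂ ∧ IsAltMatrix x₃ ∧
      (∀ i, x₁ i ∈ syz f) ∧ (∀ i, x₂ i ∈ syz f) ∧ (∀ i, x₃ i ∈ syz f) ∧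
      z₁₂ = t₁ • x₂ - t₂ • x₁ ∧ z₁₃ = t₁ • x₃ - t₃ • x₁ ∧ z₂₃ = t₂ • x₃ - t₃ • x₂ := by
  classical
  let b := Module.finBasis S (syz f)
  let B : Matrix (Fin (Module.finrank S (syz f))) ι S := Matrix.of fun a => (b a).1
  have hB : LinearIndependent S B.row :=
    b.linearIndependent.map' (syz f).subtype (Submodule.ker_subtype _)
  have hspan : ∀ v ∈ syz f, ∃ c, c ᵥ* B = v := fun v hv => by
    refine ⟨b.repr ⟨v, hv⟩, ?_⟩
    ext j
    have := congrFun (congrArg (syz f).subtype (b.sum_repr ⟨v, hv⟩)) j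
    rw [map_sum, Finset.sum_apply] at this
    exact this
  have hrow : ∀ (X : Matrix ι (Fin (Module.finrank S (syz f))) S) i, (X * B) i ∈ syz f :=
    fun X i => by
    have : (X * B) i = ∑ a, X i a • (b a).1 := by
      ext j
      simp [Matrix.mul_apply, Finset.sum_apply, B]
    rw [this]
    exact Submodule.sum_mem _ fun a _ => Submodule.smul_mem _ _ (b a).2
  obtain ⟨c12, hc12, rfl⟩ := h12.exists_eq_transpose_mul_mul hB hspan h12f
  obtain ⟨c13, hc13, rfl⟩ := h13.exists_eq_transpose_mul_mul hB hspan h13f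
  obtain ⟨c23, hc23, rfl⟩ := h23.exists_eq_transpose_mul_mul hB hspan h23f
  have hc : t₁ • c23 - t₂ • c13 + t₃ • c12 = 0 := by
    refine transpose_injective (eq_zero_of_mul_eq_zero hB (transpose_injective ?_))
    rw [transpose_mul, transpose_transpose]
    refine eq_zero_of_mul_eq_zero hB ?_
    rw [← hz]
    simp [Matrix.mul_sub, Matrix.sub_mul, Matrix.mul_add, Matrix.add_mul]
  obtain ⟨x₁, x₂, x₃, hx₁, hx₂, hx₃, rfl, rfl, rfl⟩ := h.koszul_two_alt hc12 hc13 hc23 hc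
  have halt : ∀ {x : Matrix (Fin (Module.finrank S (syz f))) (Fin (Module.finrank S (syz f))) S},
      IsAltMatrix x → IsAltMatrix (Bᵀ * x * B) := fun hx => by
    simpa using hx.mul_mul_transpose Bᵀ
  have hmul : ∀ (s t : S)
      (x y : Matrix (Fin (Module.finrank S (syz f))) (Fin (Module.finrank S (syz f))) S),
      Bᵀ * (s • x - t • y) * B = s • (Bᵀ * x * B) - t • (Bᵀ * y * B) := fun s t x y => by
    simp [Matrix.mul_sub, Matrix.sub_mul]
  exact ⟨_, _, _, halt hx₁, halt hx₂, halt hx₃, hrow _, hrow _, hrow _, hmul _ _ _ _, hmul _ _ _ _,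
    hmul _ _ _ _⟩

lemma IsRegularTriple.exists_sub_isAltMatrix [IsNoetherianRing S] {t₁ t₂ t₃ : S}
    (h : IsRegularTriple t₁ t₂ t₃) {f : ι → S} [Module.Free S (syz f)] {a : Matrix ι ι S}
    {D₁ D₂ D₃ : Matrix ι ι S} (h1 : ∀ i, D₁ i ∈ syz f) (h2 : ∀ i, D₂ i ∈ syz f)
    (h3 : ∀ i, D₃ i ∈ syz f) (a1 : IsAltMatrix (t₁ • a - D₁)) (a2 : IsAltMatrix (t₂ • a - D₂))
    (a3 : IsAltMatrix (t₃ • a - D₃)) :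
    ∃ E : Matrix ι ι S, (∀ i, E i ∈ syz f) ∧ IsAltMatrix (a - E) := by
  have halt : ∀ {s t : S} {D D' : Matrix ι ι S},
      IsAltMatrix (s • a - D) → IsAltMatrix (t • a - D') →
      IsAltMatrix (s • D' - t • D) := fun {s t D D'} hD hD' => by
    convert (hD.smul t).sub (hD'.smul s) using 1
    rw [smul_sub, smul_sub, smul_comm s t]
    abel
  have hmem : ∀ {s t : S} {D D' : Matrix ι ι S}, (∀ i, D i ∈ syz f) → (∀ i, D' i ∈ syz f) →
      ∀ i, (s • D' - t • D) i ∈ syz f := fun hD hD' i =>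
    Submodule.sub_mem _ (Submodule.smul_mem _ _ (hD' i)) (Submodule.smul_mem _ _ (hD i))
  obtain ⟨x₁, x₂, x₃, ax₁, -, -, hx₁, -, -, e12, e13, -⟩ := h.koszul_two_alt_syz
    (halt a1 a2) (halt a1 a3) (halt a2 a3) (hmem h1 h2) (hmem h1 h3) (hmem h2 h3) (by
      funext i j
      simp only [Matrix.add_apply, Matrix.sub_apply, Matrix.smul_apply, smul_eq_mul,
        Matrix.zero_apply]
      ring)
  choose E hE₁ hE₂ hE₃ using fun i j => h.koszul_one
    (y₁ := (D₁ - x₁) i j) (y₂ := (D₂ - x₂) i j) (y₃ := (D₃ - x₃) i j)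
    (by
      have := congrFun (congrFun e12 i) j
      simp only [Matrix.sub_apply, Matrix.smul_apply, smul_eq_mul] at this ⊢
      linear_combination this)
    (by
      have := congrFun (congrFun e13 i) j
      simp only [Matrix.sub_apply, Matrix.smul_apply, smul_eq_mul] at this ⊢
      linear_combination this)
  have hE : t₁ • Matrix.of E = D₁ - x₁ := funext fun i => funext fun j => (hE₁ i j).symm
  refine ⟨Matrix.of E, fun i => mem_syz_of_smul_mem h.ne_zero ?_, IsAltMatrix.of_smul h.ne_zero ?_⟩
  · have := congrFun hE i
    change t₁ • Matrix.of E i = _ at this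
    rw [this]
    exact Submodule.sub_mem _ (h1 i) (hx₁ i)
  · rw [smul_sub, hE]
    convert a1.add ax₁ using 1
    abel

end AlternatingForms

section QuadraticForms

variable {R : Type*} [CommRing R] {s : ℕ} {f : Fin s → R}

/-- The ideal generated by the linear equations of the Rees algebra. -/
noncomputable def linIdeal (f : Fin s → R) : Ideal (MvPolynomial (Fin s) R) :=
  Ideal.span {q | q ∈ reesKer f ∧ q.IsHomogeneous 1}

/-- The quadratic form with matrix `a`. -/
noncomputable def quadForm (a : Matrix (Fin s) (Fin s) R) : MvPolynomial (Fin s) R :=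
  ∑ i, ∑ j, MvPolynomial.C (a i j) * (MvPolynomial.X i * MvPolynomial.X j)

lemma quadForm_add (a b : Matrix (Fin s) (Fin s) R) :
    quadForm (a + b) = quadForm a + quadForm b := by
  simp [quadForm, Finset.sum_add_distrib, add_mul]

lemma quadForm_smul (r : R) (a : Matrix (Fin s) (Fin s) R) :
    quadForm (r • a) = MvPolynomial.C r * quadForm a := by
  simp [quadForm, Finset.mul_sum, mul_assoc]

lemma quadForm_zero : quadForm (0 : Matrix (Fin s) (Fin s) R) = 0 := by
  simp [quadForm]

lemma quadForm_sub (a b : Matrix (Fin s) (Fin s) R) :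
    quadForm (a - b) = quadForm a - quadForm b := by
  simp [quadForm, Finset.sum_sub_distrib, sub_mul]

lemma eval_quadForm (a : Matrix (Fin s) (Fin s) R) :
    MvPolynomial.eval f (quadForm a) = ∑ i, ∑ j, a i j * (f i * f j) := by
  simp [quadForm]

lemma isHomogeneous_quadForm (a : Matrix (Fin s) (Fin s) R) : (quadForm a).IsHomogeneous 2 :=
  .sum _ _ _ fun i _ => .sum _ _ _ fun j _ => by
    simpa using (isHomogeneous_C _ _).mul ((isHomogeneous_X R i).mul (isHomogeneous_X R j))

lemma exists_eq_quadForm {p : MvPolynomial (Fin s) R} (hp : p.IsHomogeneous 2) :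
    ∃ a, p = quadForm a := by
  have h : p ∈ MvPolynomial.homogeneousSubmodule (Fin s) R 2 := hp
  rw [← MvPolynomial.homogeneousSubmodule_one_pow, MvPolynomial.homogeneousSubmodule_one_eq_span_X,
    pow_two, Submodule.span_mul_span] at h
  clear hp
  induction h using Submodule.span_induction with
  | mem x hx =>
    obtain ⟨_, ⟨i, rfl⟩, _, ⟨j, rfl⟩, rfl⟩ := hx
    refine ⟨Matrix.single i j 1, ?_⟩
    simp [quadForm, Matrix.single_apply, ite_and, apply_ite MvPolynomial.C]
  | zero => exact ⟨0, quadForm_zero.symm⟩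
  | add x y _ _ hx hy =>
    obtain ⟨a, rfl⟩ := hx
    obtain ⟨b, rfl⟩ := hy
    exact ⟨a + b, (quadForm_add a b).symm⟩
  | smul r x _ hx =>
    obtain ⟨a, rfl⟩ := hx
    exact ⟨r • a, by rw [quadForm_smul, MvPolynomial.smul_eq_C_mul]⟩

lemma quadForm_eq_zero_iff {a : Matrix (Fin s) (Fin s) R} : quadForm a = 0 ↔ IsAltMatrix a := by
  constructor
  · intro h
    have hev : ∀ v : Fin s → R, ∑ i, ∑ j, a i j * (v i * v j) = 0 := fun v => by
      rw [← eval_quadForm, h, map_zero]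
    have hd : ∀ i, a i i = 0 := fun i => by
      simpa [Pi.single_apply] using hev (Pi.single i 1)
    refine ⟨hd, fun i j => ?_⟩
    have := hev (Pi.single i 1 + Pi.single j 1)
    simp only [Pi.add_apply, add_mul, mul_add, Finset.sum_add_distrib] at this
    simpa [Pi.single_apply, hd, add_comm] using this
  · intro h
    have := IsAltMatrix.sum_eq_zero (D := a.map MvPolynomial.C)
      ⟨fun i => by simp [h.1], fun i j => by simp [← map_add, h.2]⟩
      (MvPolynomial.X : Fin s → MvPolynomial (Fin s) R)
    rw [← this, quadForm]
    exact Finset.sum_congr rfl fun i _ => Finset.sum_congr rfl fun j _ => by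
      rw [Matrix.map_apply]; ring

lemma linForm_mem_linIdeal {v : Fin s → R} (hv : v ∈ syz f) :
    ∑ j, MvPolynomial.C (v j) * MvPolynomial.X j ∈ linIdeal f := by
  have h1 :
      (∑ j, MvPolynomial.C (v j) * MvPolynomial.X j : MvPolynomial (Fin s) R).IsHomogeneous 1 :=
    isHomogeneous_linForm v
  refine Ideal.subset_span ⟨(mem_reesKer_iff_of_isHomogeneous h1).2 ?_, h1⟩
  simpa using mem_syz.1 hv

lemma quadForm_eq_sum (a : Matrix (Fin s) (Fin s) R) : quadForm a =
    ∑ i, MvPolynomial.X i * ∑ j, MvPolynomial.C (a i j) * MvPolynomial.X j :=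
  Finset.sum_congr rfl fun i _ => by
    rw [Finset.mul_sum]; exact Finset.sum_congr rfl fun j _ => by ring

lemma quadForm_mem_linIdeal {D : Matrix (Fin s) (Fin s) R} (hD : ∀ i, D i ∈ syz f) :
    quadForm D ∈ linIdeal f := by
  rw [quadForm_eq_sum]
  exact Ideal.sum_mem _ fun i _ => Ideal.mul_mem_left _ _ (linForm_mem_linIdeal (hD i))

lemma exists_homogeneousComponent_eq_quadForm {p : MvPolynomial (Fin s) R} (hp : p ∈ linIdeal f) :
    ∃ D : Matrix (Fin s) (Fin s) R, (∀ i, D i ∈ syz f) ∧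
      MvPolynomial.homogeneousComponent 2 p = quadForm D := by
  let _ : GradedAlgebra (MvPolynomial.homogeneousSubmodule (Fin s) R) := MvPolynomial.gradedAlgebra
  obtain ⟨c, hc, rfl⟩ := Submodule.mem_span_set.1 hp
  rw [Finsupp.sum, map_sum]
  refine Finset.sum_induction _
    (fun q => ∃ D : Matrix (Fin s) (Fin s) R, (∀ i, D i ∈ syz f) ∧ q = quadForm D) ?_ ?_ ?_
  · rintro _ _ ⟨D, hD, rfl⟩ ⟨E, hE, rfl⟩
    exact ⟨D + E, fun i => Submodule.add_mem _ (hD i) (hE i), (quadForm_add D E).symm⟩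
  · exact ⟨0, fun i => Submodule.zero_mem _, quadForm_zero.symm⟩
  · intro l hl
    obtain ⟨hlf, hl1⟩ := hc hl
    obtain ⟨v, hv⟩ := exists_eq_sum_C_mul_X hl1
    obtain ⟨g, hg⟩ := exists_eq_sum_C_mul_X
      (MvPolynomial.homogeneousComponent_isHomogeneous 1 (c l))
    have h2 : MvPolynomial.homogeneousComponent 2 (c l • l) =
        MvPolynomial.homogeneousComponent 1 (c l) * l := by
      have := DirectSum.coe_decompose_mul_of_right_mem_of_le
        (𝒜 := MvPolynomial.homogeneousSubmodule (Fin s) R) (a := c l) (n := 2) (i := 1) hl1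
        (by simp)
      rwa [← MvPolynomial.decomposition.decompose'_apply,
        ← MvPolynomial.decomposition.decompose'_apply]
    refine ⟨Matrix.of fun i j => g i * v j, fun i => ?_, ?_⟩
    · have : v ∈ syz f := by
        rw [mem_reesKer_iff_of_isHomogeneous hl1, hv] at hlf
        exact mem_syz.2 (by simpa using hlf)
      exact Submodule.smul_mem _ (g i) this
    · rw [h2, hg, hv, quadForm_eq_sum, Finset.sum_mul]
      refine Finset.sum_congr rfl fun i _ => ?_
      simp only [Matrix.of_apply, map_mul, Finset.mul_sum]
      exact Finset.sum_congr rfl fun j _ => by ring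

lemma quadForm_mem_linIdeal_iff {a : Matrix (Fin s) (Fin s) R} :
    quadForm a ∈ linIdeal f ↔
      ∃ D : Matrix (Fin s) (Fin s) R, (∀ i, D i ∈ syz f) ∧ IsAltMatrix (a - D) := by
  constructor
  · intro h
    obtain ⟨D, hD, hDa⟩ := exists_homogeneousComponent_eq_quadForm h
    rw [MvPolynomial.homogeneousComponent_eq_self (isHomogeneous_quadForm a)] at hDa
    exact ⟨D, hD, quadForm_eq_zero_iff.1 (by rw [quadForm_sub, hDa, sub_self])⟩
  · rintro ⟨D, hD, h⟩
    rw [← quadForm_eq_zero_iff, quadForm_sub, sub_eq_zero] at h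
    exact h ▸ quadForm_mem_linIdeal hD

end QuadraticForms

section ColonIdeal

lemma exists_isPrime_mem_iff {R : Type*} [CommRing R] [IsNoetherianRing R] {Q : Ideal R}
    (hQ : Q ≠ ⊤) : ∃ (m : Ideal R) (r : R), m.IsPrime ∧ ∀ x, x ∈ m ↔ x * r ∈ Q := by
  have : Nontrivial (R ⧸ Q) := Ideal.Quotient.nontrivial_iff.2 hQ
  obtain ⟨m, hm, -⟩ := exists_le_isAssociatedPrime_of_isNoetherianRing R (1 : R ⧸ Q) one_ne_zero
  obtain ⟨hp, y, hy⟩ := Submodule.isAssociatedPrime_iff.1 hm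
  obtain ⟨r, rfl⟩ := Ideal.Quotient.mk_surjective y
  refine ⟨m, r, hp, fun x => ?_⟩
  rw [hy, Submodule.mem_colon_singleton, Submodule.mem_bot, Algebra.smul_def,
    Ideal.Quotient.algebraMap_eq, ← map_mul, Ideal.Quotient.eq_zero_iff_mem]

lemma mem_linIdeal_of_forall {R : Type*} [CommRing R] [IsNoetherianRing R] {s : ℕ} {f : Fin s → R}
    (h : ∀ m : Ideal R, m.IsPrime → ∀ a : Matrix (Fin s) (Fin s) R, quadForm a ∈ reesKer f →
      (∀ x ∈ m, quadForm (x • a) ∈ linIdeal f) → ∃ x ∉ m, quadForm (x • a) ∈ linIdeal f)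
    {a : Matrix (Fin s) (Fin s) R} (ha : quadForm a ∈ reesKer f) : quadForm a ∈ linIdeal f := by
  let Q : Ideal R :=
    { carrier := {r | quadForm (r • a) ∈ linIdeal f}
      add_mem' := fun {x y} hx hy => by
        rw [Set.mem_ofPred_eq, add_smul, quadForm_add]
        exact Ideal.add_mem _ hx hy
      zero_mem' := by
        rw [Set.mem_ofPred_eq, zero_smul, quadForm_zero]
        exact Ideal.zero_mem _
      smul_mem' := fun c x hx => by
        rw [Set.mem_ofPred_eq, smul_eq_mul, mul_smul, quadForm_smul]
        exact Ideal.mul_mem_left _ _ hx }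
  have hQ : ∀ r, r ∈ Q ↔ quadForm (r • a) ∈ linIdeal f := fun r => Iff.rfl
  by_cases hT : Q = ⊤
  · have := (hQ 1).1 (hT ▸ Submodule.mem_top)
    rwa [one_smul] at this
  obtain ⟨m, r, hm, hr⟩ := exists_isPrime_mem_iff hT
  simp only [hQ, mul_smul] at hr
  obtain ⟨x, hx, hxa⟩ := h m hm (r • a)
    (by rw [quadForm_smul]; exact Ideal.mul_mem_left _ _ ha) fun x hx => (hr x).1 hx
  exact absurd ((hr x).2 hxa) hx

end ColonIdeal

section TwoGenerated

variable {R : Type*} [CommRing R] [IsDomain R]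

lemma IsRelPrime.exists_eq_mul_of_add_eq_zero {g₁ g₂ x y : R} (h : IsRelPrime g₁ g₂)
    (h0 : g₁ ≠ 0 ∨ g₂ ≠ 0) (hxy : g₁ * x + g₂ * y = 0) [DecompositionMonoid R] :
    ∃ e, x = e * g₂ ∧ y = -(e * g₁) := by
  rcases h0 with h0 | h0
  · obtain ⟨e, he⟩ := h.dvd_of_dvd_mul_left (z := y) ⟨-x, by linear_combination hxy⟩
    refine ⟨-e, mul_left_cancel₀ h0 ?_, by rw [he]; ring⟩
    linear_combination hxy - g₂ * he
  · obtain ⟨e, he⟩ := h.symm.dvd_of_dvd_mul_left (z := x) ⟨-y, by linear_combination hxy⟩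
    refine ⟨e, by rw [he]; ring, mul_left_cancel₀ h0 ?_⟩
    linear_combination hxy - g₁ * he

/-- A binary quadratic relation between two coprime elements comes from the linear one. -/
lemma IsRelPrime.exists_of_quadratic {g₁ g₂ a b c : R} [DecompositionMonoid R]
    (h : IsRelPrime g₁ g₂)
    (h0 : g₁ ≠ 0 ∨ g₂ ≠ 0) (habc : a * g₁ ^ 2 + b * (g₁ * g₂) + c * g₂ ^ 2 = 0) :
    ∃ e e', a = e' * g₂ ∧ b = e * g₂ - e' * g₁ ∧ c = -(e * g₁) := by
  obtain ⟨e, he, hc⟩ := h.exists_eq_mul_of_add_eq_zero h0 (x := a * g₁ + b * g₂) (y := c * g₂)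
    (by linear_combination habc)
  obtain ⟨e', ha, hb⟩ := h.exists_eq_mul_of_add_eq_zero h0 (x := a) (y := b - e)
    (by linear_combination he)
  obtain ⟨e'', hb', hc'⟩ := h.exists_eq_mul_of_add_eq_zero h0 (x := e) (y := c)
    (by linear_combination hc)
  exact ⟨e'', e', ha, by linear_combination hb + hb', hc'⟩

omit [IsDomain R] in
lemma exists_prime_mem_of_mem [UniqueFactorizationMonoid R] {m : Ideal R} [hm : m.IsPrime] {d : R}
    (hd0 : d ≠ 0) (hd : d ∈ m) : ∃ π, Prime π ∧ π ∈ m ∧ π ∣ d := by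
  obtain ⟨F, hF, u, hu⟩ := UniqueFactorizationMonoid.exists_prime_factors d hd0
  rw [← hu] at hd
  have hd' := (hm.mem_or_mem hd).resolve_right fun h =>
    hm.ne_top (Ideal.eq_top_of_isUnit_mem _ h u.isUnit)
  obtain ⟨π, hπ, hπm⟩ := (hm.multiset_prod_mem_iff_exists_mem F).1 hd'
  exact ⟨π, hF π hπ, hπm, (Multiset.dvd_prod hπ).trans ⟨u, hu.symm⟩⟩

omit [IsDomain R] in
lemma mk_C_mul {σ : Type*} (J : Ideal (MvPolynomial σ R)) (r : R) (p : MvPolynomial σ R) :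
    Ideal.Quotient.mk J (MvPolynomial.C r * p) = r • Ideal.Quotient.mk J p := by
  rw [← MvPolynomial.smul_eq_C_mul]
  exact map_smul (Ideal.Quotient.mkₐ R J) r p

omit [IsDomain R] in
lemma mk_linForm {s : ℕ} {f : Fin s → R} {v : Fin s → R} (hv : v ∈ syz f) :
    ∑ j, v j • Ideal.Quotient.mk (linIdeal f) (MvPolynomial.X j) = 0 := by
  have := Ideal.Quotient.eq_zero_iff_mem.2 (linForm_mem_linIdeal hv)
  rw [map_sum] at this
  rw [← this]
  exact Finset.sum_congr rfl fun j _ => (mk_C_mul _ _ _).symm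

omit [IsDomain R] in
lemma mk_quadForm {s : ℕ} {f : Fin s → R} (a : Matrix (Fin s) (Fin s) R) :
    Ideal.Quotient.mk (linIdeal f) (quadForm a) = ∑ i, ∑ j, a i j •
      (Ideal.Quotient.mk (linIdeal f) (MvPolynomial.X i) *
        Ideal.Quotient.mk (linIdeal f) (MvPolynomial.X j)) := by
  rw [quadForm, map_sum]
  refine Finset.sum_congr rfl fun i _ => ?_
  rw [map_sum]
  refine Finset.sum_congr rfl fun j _ => ?_
  rw [mk_C_mul, map_mul]

omit [IsDomain R] in
lemma sq_smul_sum_sum {S : Type*} [CommRing S] [Algebra R S] {s : ℕ} {x : Fin s → S} {c : R}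
    {α β : Fin s → R} {u v : S} (h : ∀ i, c • x i = α i • u + β i • v)
    (a : Matrix (Fin s) (Fin s) R) :
    c ^ 2 • ∑ i, ∑ j, a i j • (x i * x j) =
      (∑ i, ∑ j, a i j * (α i * α j)) • u ^ 2 +
      (∑ i, ∑ j, a i j * (α i * β j + β i * α j)) • (u * v) +
      (∑ i, ∑ j, a i j * (β i * β j)) • v ^ 2 := by
  simp only [Finset.smul_sum, Finset.sum_smul, ← Finset.sum_add_distrib]
  refine Finset.sum_congr rfl fun i _ => Finset.sum_congr rfl fun j _ => ?_
  have : c ^ 2 • a i j • (x i * x j) = a i j • ((c • x i) * (c • x j)) := by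
    simp only [Algebra.smul_def, map_pow]; ring
  rw [this, h, h]
  simp only [Algebra.smul_def, map_mul, map_add]
  ring

omit [IsDomain R] in
lemma sum_sum_mul_smul {S ι : Type*} [Fintype ι] [AddCommGroup S] [Module R S] (c d : R)
    (a : Matrix ι ι R) (y : ι → ι → S) :
    ∑ i, ∑ j, ((c * d) • a) i j • y i j = d • c • ∑ i, ∑ j, a i j • y i j := by
  simp only [Finset.smul_sum, smul_smul, Matrix.smul_apply, smul_eq_mul]
  exact Finset.sum_congr rfl fun i _ => Finset.sum_congr rfl fun j _ => by ring_nf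

omit [IsDomain R] in
lemma smul_quadratic_eq_zero {S : Type*} [CommRing S] [Algebra R S] {d g₁ g₂ : R} {u v : S}
    (h : d • (g₂ • u - g₁ • v) = 0) (e e' : R) :
    d • ((e' * g₂) • u ^ 2 + (e * g₂ - e' * g₁) • (u * v) + (-(e * g₁)) • v ^ 2) = 0 := by
  have : d • ((e' * g₂) • u ^ 2 + (e * g₂ - e' * g₁) • (u * v) + (-(e * g₁)) • v ^ 2) =
      (e' • u + e • v) * d • (g₂ • u - g₁ • v) := by
    simp only [Algebra.smul_def, map_mul, map_sub, map_neg]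
    ring
  rw [this, h, mul_zero]

lemma exists_quadForm_smul_mem_of_relPrime [DecompositionMonoid R] {s : ℕ} {f : Fin s → R}
    {c d g₁ g₂ : R} (hd : d ≠ 0) (hg : IsRelPrime g₁ g₂) (hg0 : g₁ ≠ 0 ∨ g₂ ≠ 0)
    (h₁ : d * g₁ ∈ Ideal.span (Set.range f)) (h₂ : d * g₂ ∈ Ideal.span (Set.range f))
    (hc : ∀ i, c * f i ∈ Ideal.span {d * g₁, d * g₂}) {a : Matrix (Fin s) (Fin s) R}
    (ha : quadForm a ∈ reesKer f) : quadForm ((c ^ 2 * d) • a) ∈ linIdeal f := by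
  obtain ⟨u, hu⟩ := (Submodule.mem_span_range_iff_exists_fun R).1 h₁
  obtain ⟨v, hv⟩ := (Submodule.mem_span_range_iff_exists_fun R).1 h₂
  simp only [smul_eq_mul] at hu hv
  choose α β hαβ using fun i => Ideal.mem_span_pair.1 (hc i)
  rw [mem_reesKer_iff_of_isHomogeneous (isHomogeneous_quadForm a), eval_quadForm] at ha
  have hq := sq_smul_sum_sum (R := R) (S := R) (x := f) (c := c) (α := α) (β := β) (u := d * g₁)
    (v := d * g₂) (fun i => (hαβ i).symm) a
  simp only [smul_eq_mul, ha, mul_zero] at hq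
  let x : Fin s → MvPolynomial (Fin s) R ⧸ linIdeal f :=
    fun i => Ideal.Quotient.mk _ (MvPolynomial.X i)
  let N : (Fin s → R) →ₗ[R] MvPolynomial (Fin s) R ⧸ linIdeal f := Fintype.linearCombination R x
  have hN : ∀ w ∈ syz f, N w = 0 := fun w hw => mk_linForm hw
  have hsyz : ∀ w, w ∈ syz f ↔ Fintype.linearCombination R f w = 0 := fun w => Iff.rfl
  have hx : ∀ i, c • x i = α i • N u + β i • N v := fun i => by
    have := hN (c • Pi.single i 1 - α i • u - β i • v) (by
      rw [hsyz]
      simp only [map_sub, map_smul, Fintype.linearCombination_apply_single]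
      simp only [Fintype.linearCombination_apply, smul_eq_mul, hu, hv]
      linear_combination -hαβ i)
    simp only [map_sub, map_smul, N, Fintype.linearCombination_apply_single, one_smul] at this
    linear_combination this
  have hUV : d • (g₂ • N u - g₁ • N v) = 0 := by
    rw [← map_smul, ← map_smul, ← map_sub, ← map_smul]
    refine hN _ ?_
    rw [hsyz]
    simp only [map_sub, map_smul]
    simp only [Fintype.linearCombination_apply, smul_eq_mul, hu, hv]
    ring
  obtain ⟨e, e', hA, hB, hC⟩ := hg.exists_of_quadratic hg0
    (a := ∑ i, ∑ j, a i j * (α i * α j)) (b := ∑ i, ∑ j, a i j * (α i * β j + β i * α j))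
    (c := ∑ i, ∑ j, a i j * (β i * β j))
    (mul_left_cancel₀ (pow_ne_zero 2 hd) (by linear_combination -hq))
  rw [← Ideal.Quotient.eq_zero_iff_mem, mk_quadForm]
  refine (sum_sum_mul_smul (c ^ 2) d a fun i j => x i * x j).trans ?_
  rw [sq_smul_sum_sum hx, hA, hB, hC]
  exact smul_quadratic_eq_zero hUV e e'

lemma exists_quadForm_smul_mem_of_locGenLE [UniqueFactorizationMonoid R] {s : ℕ} {f : Fin s → R}
    {m : Ideal R} [hm : m.IsPrime] (hloc : LocGenLE (Ideal.span (Set.range f)) m 2)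
    (hprime : ∀ π ∈ m, Prime π → ¬ Ideal.span (Set.range f) ≤ Ideal.span {π})
    {a : Matrix (Fin s) (Fin s) R} (ha : quadForm a ∈ reesKer f) :
    ∃ x ∉ m, quadForm (x • a) ∈ linIdeal f := by
  obtain ⟨c, hcm, g, hg⟩ := hloc
  have hcI : ∀ x ∈ Ideal.span (Set.range f), c * x ∈ Ideal.span {(g 0).1, (g 1).1} := fun x hx => by
    obtain ⟨w, hw⟩ := (Submodule.mem_span_range_iff_exists_fun R).1 (hg ⟨x, hx⟩)
    refine Ideal.mem_span_pair.2 ⟨w 0, w 1, ?_⟩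
    simpa [Fin.sum_univ_two] using congrArg Subtype.val hw
  have hcf : ∀ i, c * f i ∈ Ideal.span {(g 0).1, (g 1).1} := fun i =>
    hcI _ (Ideal.subset_span ⟨i, rfl⟩)
  have hc0 : c ≠ 0 := fun h => hcm (h ▸ m.zero_mem)
  by_cases h0 : (g 0).1 = 0 ∧ (g 1).1 = 0
  · refine ⟨1, hm.one_notMem, quadForm_mem_linIdeal_iff.2 ⟨a, fun i => mem_syz.2 ?_, ?_⟩⟩
    · refine Finset.sum_eq_zero fun j _ => ?_
      have := hcf j
      rw [h0.1, h0.2, Set.pair_eq_singleton, Ideal.span_singleton_zero, Ideal.mem_bot,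
        mul_eq_zero] at this
      rw [this.resolve_left hc0, mul_zero]
    · rw [one_smul, sub_self]
      exact ⟨fun i => rfl, fun i j => add_zero 0⟩
  obtain ⟨g₁, g₂, d, hrel, h₁, h₂⟩ : ∃ g₁ g₂ d : R, IsRelPrime g₁ g₂ ∧ d * g₁ = (g 0).1 ∧
      d * g₂ = (g 1).1 := by
    by_cases h1 : (g 1).1 = 0
    · obtain ⟨b, a, d, h, hb, ha⟩ :=
        UniqueFactorizationMonoid.exists_reduced_factors' (g 1).1 (g 0).1 fun h => h0 ⟨h, h1⟩
      exact ⟨a, b, d, h.symm, ha, hb⟩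
    · exact UniqueFactorizationMonoid.exists_reduced_factors' (g 0).1 (g 1).1 h1
  have hd0 : d ≠ 0 := by
    rintro rfl
    exact h0 ⟨by rw [← h₁, zero_mul], by rw [← h₂, zero_mul]⟩
  have hg0 : g₁ ≠ 0 ∨ g₂ ≠ 0 := by
    by_contra! h
    exact h0 ⟨by rw [← h₁, h.1, mul_zero], by rw [← h₂, h.2, mul_zero]⟩
  have hdm : d ∉ m := fun hd => by
    obtain ⟨π, hπ, hπm, hπd⟩ := exists_prime_mem_of_mem hd0 hd
    refine hprime π hπm hπ fun x hx => ?_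
    obtain ⟨p, q, hpq⟩ := Ideal.mem_span_pair.1 (hcI x hx)
    have : π ∣ c * x := by
      rw [← hpq, ← h₁, ← h₂]
      exact dvd_add ((hπd.mul_right _).mul_left _) ((hπd.mul_right _).mul_left _)
    exact Ideal.mem_span_singleton.2 ((hπ.dvd_or_dvd this).resolve_left fun h =>
      hcm (m.mem_of_dvd h hπm))
  refine ⟨c ^ 2 * d, fun h => (hm.mem_or_mem h).elim (fun h => hcm (hm.mem_of_pow_mem _ h)) hdm,
    exists_quadForm_smul_mem_of_relPrime hd0 hrel hg0 ?_ ?_ ?_ ha⟩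
  · rw [h₁]; exact (g 0).2
  · rw [h₂]; exact (g 1).2
  · rw [h₁, h₂]; exact hcf

end TwoGenerated

section LocalizationAtMaximal

variable {A : Type*} [CommRing A] [IsDomain A] {s : ℕ} {f : Fin s → A}

omit [IsDomain A] in
lemma map_mem_syz {S : Type*} [CommRing S] (g : A →+* S) {v : Fin s → A} (hv : v ∈ syz f) :
    g ∘ v ∈ syz (g ∘ f) := by
  rw [mem_syz] at hv ⊢
  simpa [map_sum] using congrArg g hv

lemma exists_smul_sub_isAltMatrix_of_localization {m : Ideal A} [m.IsPrime]
    {a : Matrix (Fin s) (Fin s) A} {E : Matrix (Fin s) (Fin s) (Localization.AtPrime m)}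
    (hE : ∀ i, E i ∈ syz (algebraMap A (Localization.AtPrime m) ∘ f))
    (ha : IsAltMatrix (a.map (algebraMap A (Localization.AtPrime m)) - E)) :
    ∃ x ∉ m, ∃ D : Matrix (Fin s) (Fin s) A, (∀ i, D i ∈ syz f) ∧ IsAltMatrix (x • a - D) := by
  set g := algebraMap A (Localization.AtPrime m) with hg
  have hinj : Function.Injective g :=
    IsLocalization.injective _ m.primeCompl_le_nonZeroDivisors
  obtain ⟨b, hb⟩ := IsLocalization.exist_integer_multiples_of_finite m.primeCompl
    fun p : Fin s × Fin s => E p.1 p.2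
  choose D hD using hb
  have hD' : ∀ i j, g (D (i, j)) = g b * E i j := fun i j => by
    rw [hD, Algebra.smul_def]
  refine ⟨b, b.2, Matrix.of fun i j => D (i, j), fun i => ?_, ?_⟩
  · rw [mem_syz]
    refine hinj ?_
    have := mem_syz.1 (hE i)
    simp only [Matrix.of_apply, map_sum, map_mul, hD', map_zero]
    simp only [Function.comp_apply] at this
    simp only [mul_assoc, ← Finset.mul_sum, this, mul_zero]
  · rw [← isAltMatrix_map_iff hinj]
    convert ha.smul (g b) using 1
    ext i j
    simp [hD', mul_sub]

lemma exists_quadForm_smul_mem_of_free {m : Ideal A} [m.IsPrime] [IsNoetherianRing A]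
    {t : Fin 3 → Localization.AtPrime m} (ht : IsRegularTriple (t 0) (t 1) (t 2))
    (htm : ∀ i, t i ∈ IsLocalRing.maximalIdeal (Localization.AtPrime m))
    [Module.Free (Localization.AtPrime m) (syz (algebraMap A (Localization.AtPrime m) ∘ f))]
    {a : Matrix (Fin s) (Fin s) A} (ha : ∀ x ∈ m, quadForm (x • a) ∈ linIdeal f) :
    ∃ x ∉ m, quadForm (x • a) ∈ linIdeal f := by
  set g := algebraMap A (Localization.AtPrime m) with hg
  let J : Ideal (Localization.AtPrime m) :=
    { carrier := {y | ∃ D : Matrix (Fin s) (Fin s) _, (∀ i, D i ∈ syz (g ∘ f)) ∧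
        IsAltMatrix (y • a.map g - D)}
      add_mem' := by
        rintro x y ⟨D, hD, hx⟩ ⟨E, hE, hy⟩
        refine ⟨D + E, fun i => Submodule.add_mem _ (hD i) (hE i), ?_⟩
        convert hx.add hy using 1
        rw [add_smul]; abel
      zero_mem' := ⟨0, fun i => Submodule.zero_mem _, fun i => by simp, fun i j => by simp⟩
      smul_mem' := by
        rintro c x ⟨D, hD, hx⟩
        refine ⟨c • D, fun i => Submodule.smul_mem _ _ (hD i), ?_⟩
        convert hx.smul c using 1
        rw [smul_sub, smul_smul, smul_eq_mul] }
  have hJ : IsLocalRing.maximalIdeal (Localization.AtPrime m) ≤ J := by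
    rw [← IsLocalization.AtPrime.map_eq_maximalIdeal m, Ideal.map_le_iff_le_comap]
    intro x hx
    obtain ⟨D, hD, hDa⟩ := quadForm_mem_linIdeal_iff.1 (ha x hx)
    refine ⟨D.map g, fun i => map_mem_syz g (hD i), ?_⟩
    have hinj : Function.Injective g :=
      IsLocalization.injective _ m.primeCompl_le_nonZeroDivisors
    rw [← isAltMatrix_map_iff hinj] at hDa
    convert hDa using 1
    ext i j
    simp only [Matrix.sub_apply, Matrix.smul_apply, Matrix.map_apply, smul_eq_mul, map_sub, map_mul,
      hg]
  obtain ⟨D₀, h0, a0⟩ := hJ (htm 0)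
  obtain ⟨D₁, h1, a1⟩ := hJ (htm 1)
  obtain ⟨D₂, h2, a2⟩ := hJ (htm 2)
  obtain ⟨E, hE, hEa⟩ := ht.exists_sub_isAltMatrix h0 h1 h2 a0 a1 a2
  obtain ⟨x, hx, hD⟩ := exists_smul_sub_isAltMatrix_of_localization hE hEa
  exact ⟨x, hx, quadForm_mem_linIdeal_iff.2 hD⟩

end LocalizationAtMaximal

section Syzygetic

variable {A : Type*} [CommRing A] {I : Ideal A} {r : ℕ} {P : Fin r → Ideal A}

lemma mem_map_of_forall_mul_mem (hprime : ∀ j, (P j).IsPrime) (hIP : I = ⨅ j, P j) {m : Ideal A}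
    [hm : m.IsPrime] (hmP : ∀ j, ¬ m ≤ P j) {e : Localization.AtPrime m}
    (he : ∀ z ∈ m, algebraMap A (Localization.AtPrime m) z * e ∈
      I.map (algebraMap A (Localization.AtPrime m))) :
    e ∈ I.map (algebraMap A (Localization.AtPrime m)) := by
  obtain ⟨⟨x, v⟩, hxv⟩ := IsLocalization.surj m.primeCompl e
  have hx : ∀ z ∈ m, ∃ u ∉ m, u * (z * x) ∈ I := fun z hz => by
    have := Ideal.mul_mem_right (algebraMap A (Localization.AtPrime m) v) _ (he z hz)
    rw [mul_assoc, hxv, ← map_mul,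
      IsLocalization.algebraMap_mem_map_algebraMap_iff m.primeCompl] at this
    exact this
  have key : ∀ j, ∃ c ∉ m, c * x ∈ P j := fun j => by
    have := hprime j
    by_cases hj : P j ≤ m
    · obtain ⟨z, hzm, hzP⟩ := Set.not_subset.1 (hmP j)
      obtain ⟨u, hu, hux⟩ := hx z hzm
      rw [hIP, Ideal.mem_iInf] at hux
      have h1 := ((hprime j).mem_or_mem (hux j)).resolve_left fun h => hu (hj h)
      exact ⟨1, hm.one_notMem, by rw [one_mul]; exact ((hprime j).mem_or_mem h1).resolve_left hzP⟩
    · obtain ⟨c, hcP, hcm⟩ := Set.not_subset.1 hj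
      exact ⟨c, hcm, Ideal.mul_mem_right _ _ hcP⟩
  choose c hcm hcx using key
  refine (IsLocalization.mem_map_algebraMap_iff m.primeCompl _).2
    ⟨⟨⟨(∏ j, c j) * x, ?_⟩, ⟨∏ j, c j, ?memCompl⟩ * v⟩, ?_⟩
  · rw [hIP, Ideal.mem_iInf]
    exact fun j => Ideal.mem_of_dvd _
      (mul_dvd_mul_right (Finset.dvd_prod_of_mem _ (Finset.mem_univ j)) x) (hcx j)
  case memCompl =>
    change _ ∉ m
    rw [hm.prod_mem_iff]
    rintro ⟨j, -, hj⟩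
    exact hcm j hj
  · simp only [Submonoid.coe_mul, map_mul, ← hxv]
    ring

variable [IsDomain A] [UniqueFactorizationMonoid A] [IsRegularRing A]

lemma exists_quadForm_smul_mem (hA : ringKrullDim A ≤ 3) (hprime : ∀ j, (P j).IsPrime)
    (hht : ∀ j, (P j).height = 2) (hIP : I = ⨅ j, P j)
    (hirr : ∀ j, ¬ (⨅ j' : {j' : Fin r // j' ≠ j}, P j') ≤ P j) {s : ℕ} {f : Fin s → A}
    (hf : Ideal.span (Set.range f) = I) {m : Ideal A} [hm : m.IsPrime]
    {a : Matrix (Fin s) (Fin s) A} (ha : quadForm a ∈ reesKer f)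
    (ham : ∀ x ∈ m, quadForm (x • a) ∈ linIdeal f) : ∃ x ∉ m, quadForm (x • a) ∈ linIdeal f := by
  by_cases hIm : I ≤ m
  swap
  · refine exists_quadForm_smul_mem_of_locGenLE
      (hf ▸ (locGenLE_one_of_not_le hIm).mono one_le_two) (fun π hπ _ h => hIm ?_) ha
    exact (hf ▸ h).trans ((Ideal.span_singleton_le_iff_mem _).2 hπ)
  by_cases hmP : ∃ j, P j = m
  · obtain ⟨j, rfl⟩ := hmP
    refine exists_quadForm_smul_mem_of_locGenLE
      (hf ▸ locGenLE_two_of_height_eq_two hprime hht hIP hirr j) (fun π _ hπ h => ?_) ha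
    have hπp : (Ideal.span {π}).IsPrime := (Ideal.span_singleton_prime hπ.ne_zero).2 hπ
    obtain ⟨i, hi⟩ := exists_le_of_iInf_le hIP hπp (hf ▸ h)
    have h1 : (Ideal.span {π}).height ≤ 1 := Ideal.height_le_one_of_isPrincipal_of_mem_minimalPrimes
      (Ideal.span {π}) _ (by rw [Ideal.minimalPrimes_eq_subsingleton_self]; rfl)
    have h2 := (Ideal.height_mono hi).trans h1
    rw [hht] at h2
    exact absurd h2 (by decide)
  have hmax : m.IsMaximal := by
    by_contra h
    exact hmP (eq_of_isPrime_of_not_isMaximal hA hprime hht hIP hm h hIm)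
  obtain ⟨j, hj⟩ := exists_le_of_iInf_le hIP hm hIm
  have h3 : m.height = 3 := by
    refine le_antisymm ?_ ?_
    · exact WithBot.coe_le_coe.1 ((Ideal.height_le_ringKrullDim_of_ne_top hm.ne_top).trans hA)
    · have := hprime j
      calc (3 : ℕ∞) = (P j).height + 1 := by rw [hht]; norm_num
        _ ≤ _ := height_add_one_le_of_lt (lt_of_le_of_ne hj fun h => hmP ⟨j, h⟩)
  have hnle : ∀ j, ¬ m ≤ P j := fun j h =>
    hmP ⟨j, (hmax.eq_of_le (hprime j).ne_top h).symm⟩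
  obtain ⟨t, ht⟩ := exists_maximalIdeal_eq_span m (n := 3) h3
  have hrange : Set.range t = {t 0, t 1, t 2} := by
    ext x
    simp [Fin.exists_fin_succ, eq_comm]
  have ht' := hrange ▸ ht
  have hreg : IsRegularTriple (t 0) (t 1) (t 2) := by
    refine isRegularTriple_of_maximalIdeal_eq_span ht' ?_
    have h4 : ((IsLocalRing.maximalIdeal (Localization.AtPrime m)).height : WithBot ℕ∞) = 3 := by
      rw [IsLocalRing.maximalIdeal_height_eq_ringKrullDim,
        IsLocalization.AtPrime.ringKrullDim_eq_height m, h3]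
      rfl
    exact WithBot.coe_le_coe.1 h4.ge
  have hmap : Ideal.span (Set.range (algebraMap A (Localization.AtPrime m) ∘ f)) =
      I.map (algebraMap A (Localization.AtPrime m)) := by
    rw [← hf, Ideal.map_span, Set.range_comp]
  have hfree := hreg.free_syz ht' (algebraMap A (Localization.AtPrime m) ∘ f) fun e h0 h1 h2 => by
    rw [hmap] at *
    refine mem_map_of_forall_mul_mem hprime hIP hnle fun z hz => ?_
    have : algebraMap A (Localization.AtPrime m) z ∈
        IsLocalRing.maximalIdeal (Localization.AtPrime m) := by
      rw [← IsLocalization.AtPrime.map_eq_maximalIdeal m]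
      exact Ideal.mem_map_of_mem _ hz
    rw [ht', Ideal.mem_span_insert] at this
    obtain ⟨p, w, hw, hz'⟩ := this
    obtain ⟨q, u, rfl⟩ := Ideal.mem_span_pair.1 hw
    have : algebraMap A (Localization.AtPrime m) z * e = p * (t 0 * e) + q * (t 1 * e) +
        u * (t 2 * e) := by rw [hz']; ring
    rw [this]
    exact Ideal.add_mem _ (Ideal.add_mem _ (Ideal.mul_mem_left _ _ h0) (Ideal.mul_mem_left _ _ h1))
      (Ideal.mul_mem_left _ _ h2)
  exact exists_quadForm_smul_mem_of_free hreg
    (fun i => ht ▸ Ideal.subset_span (Set.mem_range_self i)) ham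

/-- Over a regular factorial domain of dimension three, an irredundant intersection of primes of
height two is syzygetic. -/
lemma syzygetic_of_height_eq_two (hA : ringKrullDim A ≤ 3) (hprime : ∀ j, (P j).IsPrime)
    (hht : ∀ j, (P j).height = 2) (hIP : I = ⨅ j, P j)
    (hirr : ∀ j, ¬ (⨅ j' : {j' : Fin r // j' ≠ j}, P j') ≤ P j) : Syzygetic I := by
  intro s f hf p hp hp2
  obtain ⟨a, rfl⟩ := exists_eq_quadForm hp2
  exact mem_linIdeal_of_forall (fun m _ a ha ham =>
    exists_quadForm_smul_mem hA hprime hht hIP hirr hf ha ham) hp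

end Syzygetic

/-- Let `I` be a radical ideal of `k[x,y,z]` that is an irredundant intersection of prime
ideals of height `2`. If `I` is minimally generated by at least four elements, then `I` is
syzygetic and `rt(I) ≥ 3`. -/
theorem syzygetic_and_relType_ge_three {k : Type*} [Field k]
    (I : Ideal (MvPolynomial (Fin 3) k)) {r : ℕ}
    (P : Fin r → Ideal (MvPolynomial (Fin 3) k))
    (hprime : ∀ j, (P j).IsPrime)
    (hht : ∀ j, idealHeight (P j) = (2 : ℕ∞))
    (hIP : I = ⨅ j, P j)
    (hirr : ∀ j, ¬ (⨅ j' : {j' : Fin r // j' ≠ j}, P j') ≤ P j)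
    (hmin : ∀ (s : ℕ) (f : Fin s → MvPolynomial (Fin 3) k),
      Ideal.span (Set.range f) = I → 4 ≤ s) :
    Syzygetic I ∧ 3 ≤ relType I := by
  have hht' : ∀ j, (P j).height = 2 := fun j => by
    have := hprime j
    exact (height_eq_of_idealHeight (P j)).trans (hht j)
  have hI : Syzygetic I :=
    syzygetic_of_height_eq_two (ringKrullDim_mvPolynomial k 3).le hprime hht' hIP hirr
  refine ⟨hI, ?_⟩
  by_contra! h
  obtain ⟨s, f, hf⟩ := Submodule.fg_iff_exists_fin_generating_family.1 (IsNoetherian.noetherian I)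
  have hL := reesKer_le_span_linear_of_relType_le_two hI (Nat.le_of_lt_succ h) hf
  have hF : ¬ IsField (MvPolynomial (Fin 3) k) := fun hF => by
    have h0 := ringKrullDim_eq_zero_of_isField hF
    rw [ringKrullDim_mvPolynomial] at h0
    exact absurd h0 (by decide)
  obtain ⟨g, hg⟩ := exists_span_three hprime hht' hIP hirr fun m hm =>
    locGenLE_of_reesKer_le (Ring.ne_bot_of_isMaximal_of_not_isField hm hF) hf hL
  exact absurd (hmin 3 g hg) (by decide)
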